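/- arXiv:1604.06304 — 4 statements merged into one kernel-verified Lean document; each statement's English description precedes it below -/
import Mathlib

section
/- For 1 ≤ i < j ≤ d and k, ℓ ∈ ℕ, the mixed scalar product of the basis polynomials over the simplex satisfies ∫_△ φ_{i,k}(x_i) φ_{j,ℓ}(x_j) dx = 1_{k=ℓ} · √((j-1)!(d-i)! / ((i-1)!(d-j)!)) · √((k+d-j)!(k+i-1)! / ((k+d-i)!(k+j-1)!)), and this quantity lies in [0,1]. -/
open MeasureTheory Real

def simplexD (d : ℕ) : Set (Fin d → ℝ) :=
  {x | (∀ i, x i ∈ Set.Icc (0:ℝ) 1) ∧ ∀ i j : Fin d, i ≤ j → x i ≤ x j}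

noncomputable def qMeas (d i : ℕ) : Measure ℝ :=
  volume.withDensity (fun t => ENNReal.ofReal
    (Set.indicator (Set.Icc (0:ℝ) 1)
      (fun s => (1-s)^(d-i) * s^(i-1) / ((d-i).factorial * (i-1).factorial)) t))

noncomputable def jacobiP (a b k : ℕ) (t : ℝ) : ℝ :=
  (-1)^k / ((2:ℝ)^k * (k.factorial : ℝ) * ((1-t)^a * (1+t)^b)) *
    iteratedDeriv k (fun s => (1-s)^a * (1+s)^b * (1-s^2)^k) t

noncomputable def phiB (d i k : ℕ) (t : ℝ) : ℝ :=
  Real.sqrt ((((2*k+d) * k.factorial * (k+d-1).factorial : ℕ) : ℝ) /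
      (((k+d-i).factorial * (k+i-1).factorial : ℕ) : ℝ)) *
  Real.sqrt (((d-i).factorial * (i-1).factorial : ℕ) : ℝ) *
  jacobiP (d-i) (i-1) k (2*t-1)


def simplexT (d : ℕ) (T : ℝ) : Set (Fin d → ℝ) :=
  {x | (∀ i, x i ∈ Set.Icc (0:ℝ) T) ∧ ∀ i j : Fin d, i ≤ j → x i ≤ x j}

noncomputable def iterF (f : ℕ → ℝ → ℝ) : ℕ → ℝ → ℝ
  | 0, _ => 1
  | (m+1), t => ∫ s in (0:ℝ)..t, f m s * iterF f m s

lemma iterF_cont (f : ℕ → ℝ → ℝ) (hf : ∀ m, Continuous (f m)) (m : ℕ) : Continuous (iterF f m) := by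
  induction m with
  | zero => exact continuous_const
  | succ m ih =>
    have : Continuous (fun s => f m s * iterF f m s) := (hf m).mul ih
    exact intervalIntegral.continuous_primitive (fun a b => this.intervalIntegrable a b) 0

lemma simplexT_compact (d : ℕ) (T : ℝ) : IsCompact (simplexT d T) := by
  have h1 : IsCompact (Set.pi Set.univ (fun _ : Fin d => Set.Icc (0:ℝ) T)) :=
    isCompact_univ_pi (fun _ => isCompact_Icc)
  have h2 : IsClosed {x : Fin d → ℝ | ∀ i j : Fin d, i ≤ j → x i ≤ x j} := by
    simp only [Set.ofPred_forall]
    refine isClosed_iInter fun i => isClosed_iInter fun j => isClosed_iInter fun _ => ?_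
    exact isClosed_le (continuous_apply i) (continuous_apply j)
  convert h1.inter_right h2 using 1
  ext x
  simp only [simplexT, Set.mem_inter_iff, Set.mem_ofPred_eq, Set.mem_pi, Set.mem_univ, true_implies]

lemma simplexT_succ (d : ℕ) (T s : ℝ) (y : Fin d → ℝ) :
    (Fin.snoc y s : Fin (d+1) → ℝ) ∈ simplexT (d+1) T ↔ s ∈ Set.Icc 0 T ∧ y ∈ simplexT d s := by
  simp only [simplexT, Set.mem_ofPred_eq]
  constructor
  · rintro ⟨h1, h2⟩
    refine ⟨by simpa using h1 (Fin.last d), fun i => ⟨?_, ?_⟩, fun i j hij => ?_⟩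
    · simpa using (h1 i.castSucc).1
    · simpa using h2 i.castSucc (Fin.last d) (Fin.le_last _)
    · simpa using h2 i.castSucc j.castSucc (by simpa using hij)
  · rintro ⟨hs, h1, h2⟩
    refine ⟨fun i => ?_, fun i j => ?_⟩
    · refine Fin.lastCases ?_ (fun i => ?_) i
      · simpa using hs
      · simp only [Fin.snoc_castSucc]
        exact ⟨(h1 i).1, (h1 i).2.trans hs.2⟩
    · refine Fin.lastCases ?_ (fun i => ?_) i
      · intro h
        have : j = Fin.last d := le_antisymm (Fin.le_last _) h
        simp [this]
      · refine Fin.lastCases ?_ (fun j => ?_) j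
        · intro _; simpa using (h1 i).2
        · intro h; simpa using h2 i j (by simpa using h)

lemma simplex_integral (f : ℕ → ℝ → ℝ) (hf : ∀ m, Continuous (f m)) (d : ℕ) :
    ∀ T : ℝ, 0 ≤ T → ∫ x in simplexT d T, ∏ m : Fin d, f m (x m) = iterF f d T := by
  induction d with
  | zero =>
    intro T _
    have : simplexT 0 T = Set.univ := by
      ext x; simp [simplexT]
    simp [this, iterF, measureReal_def, volume_pi]
  | succ d ih =>
    intro T hT
    have hmeas : ∀ n t, MeasurableSet (simplexT n t) := fun n t => (simplexT_compact n t).measurableSet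
    have hcont : Continuous (fun x : Fin (d+1) → ℝ => ∏ m : Fin (d+1), f m (x m)) :=
      continuous_finsetProd _ fun m _ => (hf m).comp (continuous_apply m)
    have hint : Integrable ((simplexT (d+1) T).indicator
        (fun x : Fin (d+1) → ℝ => ∏ m : Fin (d+1), f m (x m))) :=
      (integrable_indicator_iff (hmeas _ _)).2
        (hcont.continuousOn.integrableOn_compact (simplexT_compact _ _))
    have hmp := (volume_preserving_piFinSuccAbove (fun _ : Fin (d + 1) => ℝ) (Fin.last d)).symm
    rw [← integral_indicator (hmeas _ _), ← hmp.integral_comp']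
    have hint2 := (hmp.integrable_comp_emb (MeasurableEquiv.measurableEmbedding _)).2 hint
    have key : ∀ z : ℝ × (Fin d → ℝ), (simplexT (d+1) T).indicator
        (fun x : Fin (d+1) → ℝ => ∏ m : Fin (d+1), f m (x m))
        ((MeasurableEquiv.piFinSuccAbove (fun _ : Fin (d+1) => ℝ) (Fin.last d)).symm z)
        = (Set.Icc 0 T).indicator (fun s => f d s *
          (simplexT d s).indicator (fun y => ∏ m : Fin d, f m (y m)) z.2) z.1 := by
      rintro ⟨s, y⟩
      have e : (MeasurableEquiv.piFinSuccAbove (fun _ : Fin (d+1) => ℝ) (Fin.last d)).symm (s, y)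
          = (Fin.snoc y s : Fin (d+1) → ℝ) := by
        simp [MeasurableEquiv.piFinSuccAbove_symm_apply, Fin.insertNthEquiv, Fin.insertNth_last']
      rw [e]
      have hiff := simplexT_succ d T s y
      by_cases h1 : s ∈ Set.Icc 0 T
      · by_cases h2 : y ∈ simplexT d s
        · rw [Set.indicator_of_mem (hiff.2 ⟨h1, h2⟩), Set.indicator_of_mem h1,
            Set.indicator_of_mem h2, Fin.prod_univ_castSucc]
          simp [mul_comm]
        · rw [Set.indicator_of_notMem (fun h => h2 (hiff.1 h).2), Set.indicator_of_mem h1,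
            Set.indicator_of_notMem h2, mul_zero]
      · rw [Set.indicator_of_notMem (fun h => h1 (hiff.1 h).1), Set.indicator_of_notMem h1]
    have hint3 := hint2.congr (Filter.Eventually.of_forall key)
    rw [integral_congr_ae (Filter.Eventually.of_forall key)]
    rw [Measure.volume_eq_prod, integral_prod _ hint3]
    have : ∀ s : ℝ, ∫ y : Fin d → ℝ, (Set.Icc 0 T).indicator (fun s => f d s *
          (simplexT d s).indicator (fun y => ∏ m : Fin d, f m (y m)) y) s =
          (Set.Icc 0 T).indicator (fun s => f d s * iterF f d s) s := by
      intro s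
      by_cases h1 : s ∈ Set.Icc 0 T
      · simp only [Set.indicator_of_mem h1]
        rw [integral_const_mul, integral_indicator (hmeas _ _), ih s h1.1]
      · simp [Set.indicator_of_notMem h1]
    simp only [this]
    rw [integral_indicator measurableSet_Icc, integral_Icc_eq_integral_Ioc, iterF,
      intervalIntegral.integral_of_le hT]

open Polynomial in
noncomputable def RP (a b k : ℕ) : Polynomial ℝ :=
  ∑ s ∈ Finset.range (k+1), C ((-1)^s * (k.choose s : ℝ) * ((a+k).descFactorial s : ℝ) / ((b+s).factorial : ℝ))
    * (X^s * (1-X)^(k-s))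

open Polynomial in
lemma RP_rodrigues (a b k : ℕ) :
    derivative^[k] ((X:ℝ[X])^(b+k) * (1-X)^(a+k)) =
      C ((b+k).factorial : ℝ) * (X^b * (1-X)^a * RP a b k) := by
  have h : ((1:ℝ[X])-X)^(a+k) = (X^(a+k) : ℝ[X]).comp (1-X) := by simp
  rw [h, iterate_derivative_mul, RP, Finset.mul_sum, Finset.mul_sum]
  refine Finset.sum_congr rfl fun s hs => ?_
  have hs' : s ≤ k := by simpa [Nat.lt_succ_iff] using hs
  rw [iterate_derivative_comp_one_sub_X, iterate_derivative_X_pow_eq_C_mul,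
    iterate_derivative_X_pow_eq_C_mul]
  have e1 : b + k - (k - s) = b + s := by omega
  have e2 : a + k - s = a + (k - s) := by omega
  have e3 : ((b+k).descFactorial (k-s) : ℝ) = (b+k).factorial / (b+s).factorial := by
    have := Nat.factorial_mul_descFactorial (n := b+k) (k := k-s) (by omega)
    rw [e1] at this
    rw [eq_div_iff (by positivity), ← this]; push_cast; ring
  rw [e3, e1, e2, div_eq_mul_inv, div_eq_mul_inv]
  simp only [nsmul_eq_mul, map_mul, map_pow, map_neg, map_one, mul_comp, C_comp, pow_comp, X_comp,
    pow_add, ← C_eq_natCast]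
  ring

open Polynomial in
lemma RP_deriv (a b k : ℕ) :
    derivative (X^(b+1) * RP a (b+1) k) = X^b * RP (a+1) b k := by
  have hA : ∀ s : ℕ, s ≤ k → derivative ((X:ℝ[X])^(b+1) * (X^s * (1-X)^(k-s))) =
      C ((b+1+s : ℕ) : ℝ) * (X^(b+s) * (1-X)^(k-s))
        - C ((k-s : ℕ) : ℝ) * (X^(b+(s+1)) * (1-X)^(k-(s+1))) := by
    intro s hs
    rw [← mul_assoc, ← pow_add]
    simp only [derivative_mul, derivative_pow, derivative_sub, derivative_one,
      derivative_X]
    rw [show b + 1 + s - 1 = b + s by omega, show k - s - 1 = k - (s+1) by omega,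
      show b + 1 + s = b + (s + 1) by omega]
    ring
  have hL : derivative (X^(b+1) * RP a (b+1) k) =
      ∑ s ∈ Finset.range (k+1), (C ((-1)^s * (k.choose s : ℝ) * ((a+k).descFactorial s : ℝ) / ((b+s).factorial : ℝ))
        * (X^(b+s) * (1-X)^(k-s))
      - C ((-1)^s * (k.choose s : ℝ) * ((a+k).descFactorial s : ℝ) / ((b+1+s).factorial : ℝ) * ((k-s : ℕ) : ℝ))
        * (X^(b+(s+1)) * (1-X)^(k-(s+1)))) := by
    rw [RP, Finset.mul_sum, derivative_sum]
    refine Finset.sum_congr rfl fun s hs => ?_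
    have hs' : s ≤ k := by simpa [Nat.lt_succ_iff] using hs
    rw [mul_left_comm, derivative_C_mul, hA s hs', mul_sub, ← mul_assoc (C _) (C _), ← mul_assoc (C _) (C _), ← C_mul, ← C_mul]
    congr 3
    have : ((b+1+s).factorial : ℝ) = (b+1+s : ℕ) * (b+s).factorial := by
      rw [show b+1+s = (b+s)+1 by omega, Nat.factorial_succ]; push_cast; ring
    rw [this]
    have : ((b+1+s : ℕ) : ℝ) ≠ 0 := by positivity
    field_simp
  rw [hL, Finset.sum_sub_distrib, Finset.sum_range_succ' (fun s => C _ * (X^(b+s) * (1-X)^(k-s))),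
    Finset.sum_range_succ (fun s => C (_ * ((k-s : ℕ) : ℝ)) * _)]
  rw [RP, Finset.mul_sum, Finset.sum_range_succ']
  simp only [Nat.sub_self, Nat.cast_zero, mul_zero, C_0, zero_mul, add_zero]
  rw [add_sub_right_comm, ← Finset.sum_sub_distrib]
  congr 1
  · refine Finset.sum_congr rfl fun s hs => ?_
    have hs' : s < k := by simpa using hs
    rw [← sub_mul, ← C_sub]
    have e : ((-1)^(s+1) * (k.choose (s+1) : ℝ) * ((a+k).descFactorial (s+1) : ℝ) / ((b+(s+1)).factorial : ℝ)
       - (-1)^s * (k.choose s : ℝ) * ((a+k).descFactorial s : ℝ) / ((b+1+s).factorial : ℝ) * ((k-s : ℕ) : ℝ))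
       = (-1)^(s+1) * (k.choose (s+1) : ℝ) * ((a+1+k).descFactorial (s+1) : ℝ) / ((b+(s+1)).factorial : ℝ) := by
      rw [show b+1+s = b+(s+1) by omega, show a+1+k=a+k+1 by omega, Nat.succ_descFactorial_succ,
        Nat.descFactorial_succ]
      have h1 : (k.choose (s+1) : ℝ) * (s+1) = k.choose s * ((k - s : ℕ):ℝ) := by
        exact_mod_cast Nat.choose_succ_right_eq k s
      have h2 : ((a + k - s : ℕ):ℝ) = a + k - s := by
        rw [Nat.cast_sub (by omega)]; push_cast; ring
      push_cast
      rw [h2]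
      field_simp
      rw [pow_succ]
      linear_combination (-1)^s * ((a+k).descFactorial s : ℝ) * h1
    rw [e, pow_add]; ring
  · simp; ring

open Polynomial in
lemma RP_natDegree (a b k : ℕ) : (RP a b k).natDegree ≤ k := by
  refine natDegree_sum_le_of_forall_le _ _ fun s hs => ?_
  have hs' : s ≤ k := by simpa [Nat.lt_succ_iff] using hs
  have h1 : ((1:ℝ[X]) - X).natDegree ≤ 1 := by
    refine (natDegree_sub_le _ _).trans ?_; simp
  refine (natDegree_C_mul_le _ _).trans (natDegree_mul_le.trans ?_)
  have h2 := natDegree_pow_le_of_le (k-s) h1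
  simp only [natDegree_X_pow]
  omega

open Polynomial in
lemma one_sub_X_natDegree (n : ℕ) : (((1:ℝ[X]) - X)^n).natDegree ≤ n := by
  have h1 : ((1:ℝ[X]) - X).natDegree ≤ 1 := by
    refine (natDegree_sub_le _ _).trans ?_; simp
  simpa using natDegree_pow_le_of_le n h1

open Polynomial in
lemma one_sub_X_coeff (n : ℕ) : (((1:ℝ[X]) - X)^n).coeff n = (-1)^n := by
  have h1 : ((1:ℝ[X]) - X).natDegree ≤ 1 := by
    refine (natDegree_sub_le _ _).trans ?_; simp
  have := coeff_pow_of_natDegree_le (m := n) h1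
  rw [mul_one] at this
  rw [this]; simp [coeff_one]

open Polynomial in
lemma RP_coeff (a b k : ℕ) : (RP a b k).coeff k =
    (-1)^k * ((a+b+2*k).factorial : ℝ) / ((a+b+k).factorial * (b+k).factorial) := by
  have h := congrArg (fun p => coeff p (b + (a + k))) (RP_rodrigues a b k)
  simp only [coeff_iterate_derivative, coeff_C_mul] at h
  rw [show b + (a+k) + k = (b+k) + (a+k) by omega, coeff_mul_add_eq_of_natDegree_le
    (by simp) (one_sub_X_natDegree _), one_sub_X_coeff, mul_assoc,
    coeff_mul_add_eq_of_natDegree_le (by simp) (natDegree_mul_le.trans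
      (add_le_add (one_sub_X_natDegree _) (RP_natDegree _ _ _))),
    coeff_mul_add_eq_of_natDegree_le (one_sub_X_natDegree _) (RP_natDegree _ _ _),
    one_sub_X_coeff] at h
  simp only [coeff_X_pow_self, one_mul, nsmul_eq_mul] at h
  have e := Nat.factorial_mul_descFactorial (n := b+k+(a+k)) (k := k) (by omega)
  rw [show b+k+(a+k)-k = a+b+k by omega, show b+k+(a+k) = a+b+2*k by omega] at e
  rw [show b+k+(a+k) = a+b+2*k by omega, pow_add] at h
  have e' : ((a+b+k).factorial : ℝ) * ((a+b+2*k).descFactorial k : ℝ) = (a+b+2*k).factorial := by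
    exact_mod_cast e
  rw [eq_div_iff (by positivity), ← e']
  have ha : ((-1:ℝ)^a)*(-1)^a = 1 := by rw [← mul_pow]; simp
  linear_combination (-((-1:ℝ)^a) * ((a+b+k).factorial:ℝ)) * h + (((a+b+2*k).descFactorial k:ℝ) * (-1)^k * ((a+b+k).factorial:ℝ) - ((b+k).factorial:ℝ) * (RP a b k).coeff k * ((a+b+k).factorial:ℝ)) * ha

open Polynomial in
lemma poly_parts (q u : ℝ[X]) (h0 : u.eval 0 = 0) (h1 : u.eval 1 = 0) :
    ∫ x in (0:ℝ)..1, q.eval x * (derivative u).eval x = - ∫ x in (0:ℝ)..1, (derivative q).eval x * u.eval x := by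
  rw [intervalIntegral.integral_mul_deriv_eq_deriv_mul (fun x _ => q.hasDerivAt x) (fun x _ => u.hasDerivAt x)
    ((derivative q).continuous.intervalIntegrable _ _) ((derivative u).continuous.intervalIntegrable _ _)]
  simp [h0, h1]

open Polynomial in
lemma poly_parts_iter (A B l : ℕ) (hA : l ≤ A) (hB : l ≤ B) : ∀ q : ℝ[X],
    ∫ x in (0:ℝ)..1, q.eval x * (derivative^[l] (X^B * (1-X)^A)).eval x =
     (-1)^l * ∫ x in (0:ℝ)..1, (derivative^[l] q).eval x * (X^B * (1-X)^A : ℝ[X]).eval x := by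
  induction l with
  | zero => intro q; simp
  | succ l ih =>
    intro q
    rw [Function.iterate_succ_apply', poly_parts, ih (by omega) (by omega), Function.iterate_succ_apply]
    · ring
    · have := pow_sub_dvd_iterate_derivative_of_pow_dvd (p := (X^B * (1-X)^A : ℝ[X])) (q := X) (n := B) l (Dvd.intro _ rfl)
      have := (dvd_pow_self X (by omega)).trans this
      obtain ⟨r, hr⟩ := this
      rw [hr]; simp
    · have := pow_sub_dvd_iterate_derivative_of_pow_dvd (p := (X^B * (1-X)^A : ℝ[X])) (q := 1-X) (n := A) l (Dvd.intro_left _ rfl)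
      have := (dvd_pow_self (1-X) (by omega)).trans this
      obtain ⟨r, hr⟩ := this
      rw [hr]; simp

lemma beta_nat (n : ℕ) : ∀ m : ℕ, ∫ x in (0:ℝ)..1, x^m * (1-x)^n = m.factorial * n.factorial / (m+n+1).factorial := by
  induction n with
  | zero => intro m; simp [Nat.factorial_succ]; field_simp
  | succ n ih =>
    intro m
    have := intervalIntegral.integral_mul_deriv_eq_deriv_mul (a := 0) (b := 1)
      (u := fun x : ℝ => (1-x)^(n+1)) (v := fun x => x^(m+1)/(m+1)) (u' := fun x => -((n+1) * (1-x)^n))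
      (v' := fun x => x^m)
      (fun x _ => by
        have := ((hasDerivAt_id x).const_sub 1).pow (n+1)
        refine this.congr_deriv ?_; push_cast; simp)
      (fun x _ => by
        have := (hasDerivAt_pow (m+1) x).div_const ((m:ℝ)+1)
        refine this.congr_deriv ?_; push_cast; field_simp; try simp)
      ((by fun_prop : Continuous _).intervalIntegrable _ _)
      ((by fun_prop : Continuous _).intervalIntegrable _ _)
    simp only [mul_comm (_ ^ m : ℝ)]
    rw [this]
    have e : ∀ x : ℝ, -((n+1) * (1-x)^n) * (x^(m+1)/(m+1)) = (-((n+1)/(m+1))) * (x^(m+1) * (1-x)^n) := by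
      intro x; field_simp
    simp only [e]
    rw [intervalIntegral.integral_const_mul, ih, show m+1+n+1 = m+(n+1)+1 by omega]
    simp [Nat.factorial_succ]
    field_simp

open Polynomial in
lemma RP_orth_le (a b k l : ℕ) (hkl : k ≤ l) :
    ∫ x in (0:ℝ)..1, x^b * (1-x)^a * (RP a b k).eval x * (RP a b l).eval x =
      if k = l then (k.factorial * (a+k).factorial : ℝ) / ((2*k+a+b+1) * (a+b+k).factorial * (b+k).factorial) else 0 := by
  have h := poly_parts_iter (a+l) (b+l) l (by omega) (by omega) (RP a b k)
  rw [RP_rodrigues] at h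
  have e : ∀ x : ℝ, x^b * (1-x)^a * (RP a b k).eval x * (RP a b l).eval x =
     ((b+l).factorial : ℝ)⁻¹ * ((RP a b k).eval x * (C ((b+l).factorial : ℝ) * (X^b * (1-X)^a * RP a b l)).eval x) := by
    intro x; simp; field_simp
  simp only [e]
  rw [intervalIntegral.integral_const_mul, h]
  split_ifs with hk
  · subst hk
    have hD : derivative^[k] (RP a b k) = C ((k.factorial : ℝ) * (RP a b k).coeff k) := by
      have : (derivative^[k] (RP a b k)).natDegree ≤ 0 :=
        (natDegree_iterate_derivative _ _).trans (by have := RP_natDegree a b k; omega)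
      rw [eq_C_of_natDegree_le_zero this, coeff_iterate_derivative]
      simp [Nat.descFactorial_self]
    rw [hD, RP_coeff]
    simp only [eval_C, eval_mul, eval_pow, eval_X, eval_sub, eval_one]
    rw [intervalIntegral.integral_const_mul, beta_nat, show b+k+(a+k)+1 = (a+b+2*k)+1 by omega, Nat.factorial_succ]
    have ha : ((-1:ℝ)^k)*(-1)^k = 1 := by rw [← mul_pow]; simp
    push_cast
    field_simp
    rw [pow_two, ha]; ring
  · rw [iterate_derivative_eq_zero (by have := RP_natDegree a b k; omega)]; simp

lemma RP_orth (a b k l : ℕ) :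
    ∫ x in (0:ℝ)..1, x^b * (1-x)^a * (RP a b k).eval x * (RP a b l).eval x =
      if k = l then (k.factorial * (a+k).factorial : ℝ) / ((2*k+a+b+1) * (a+b+k).factorial * (b+k).factorial) else 0 := by
  rcases le_total k l with h | h
  · exact RP_orth_le a b k l h
  · have := RP_orth_le a b l k h
    simp only [mul_right_comm _ (Polynomial.eval _ (RP a b k))]
    rw [this]
    by_cases hk : k = l
    · subst hk; rfl
    · rw [if_neg hk, if_neg (Ne.symm hk)]

open Polynomial in
lemma iteratedDeriv_poly (p : ℝ[X]) (k : ℕ) :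
    iteratedDeriv k (fun x => p.eval x) = fun x => (derivative^[k] p).eval x := by
  induction k with
  | zero => simp
  | succ k ih =>
    rw [iteratedDeriv_succ, ih]
    funext x
    rw [Polynomial.deriv, Function.iterate_succ_apply']

open Polynomial in
lemma jacobiP_eq (a b k : ℕ) (t : ℝ) (h0 : t ≠ 0) (h1 : t ≠ 1) :
    jacobiP a b k (2*t-1) = (-1)^k * (b+k).factorial / k.factorial * (RP a b k).eval t := by
  have hf : (fun s : ℝ => (1-s)^a * (1+s)^b * (1-s^2)^k) =
      fun s => (fun y => (fun x => (C ((2:ℝ)^(a+b+2*k)) * (X^(b+k) * (1-X)^(a+k)) : ℝ[X]).eval x) ((1/2) * y)) (1 + s) := by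
    funext s
    simp only [eval_mul, eval_C, eval_pow, eval_X, eval_sub, eval_one]
    have e1 : (1 - s) = 2 * (1 - 1/2 * (1+s)) := by ring
    have e2 : (1 - s^2) = (2 * (1 - 1/2 * (1+s))) * (2 * (1/2 * (1+s))) := by ring
    have e3 : 1 + s = 2 * (1/2 * (1+s)) := by ring
    rw [e2]
    nth_rewrite 1 [e1]
    nth_rewrite 2 [e3]
    generalize 1/2 * (1+s) = y
    simp only [mul_pow, pow_add, pow_mul']
    ring
  have hadd := iteratedDeriv_comp_const_add k (fun y : ℝ => (fun x => (C ((2:ℝ)^(a+b+2*k)) *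
    (X^(b+k) * (1-X)^(a+k)) : ℝ[X]).eval x) ((1/2) * y)) 1
  have hmul := iteratedDeriv_comp_const_mul (n := k) (f := fun x : ℝ => (C ((2:ℝ)^(a+b+2*k)) *
    (X^(b+k) * (1-X)^(a+k)) : ℝ[X]).eval x) (by simp only [eval_mul, eval_C, eval_pow, eval_X, eval_sub, eval_one]; fun_prop) (1/2)
  rw [jacobiP, hf, hadd, hmul, iteratedDeriv_poly, iterate_derivative_C_mul, RP_rodrigues]
  have h1' : 1 - t ≠ 0 := sub_ne_zero.2 (Ne.symm h1)
  have e1 : (1:ℝ)/2 * (1 + (2*t-1)) = t := by ring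
  have e2 : 1 - (2*t-1) = 2 * (1-t) := by ring
  have e3 : 1 + (2*t-1) = 2 * t := by ring
  simp only [e1]
  rw [e2, e3]
  simp only [eval_mul, eval_C, eval_pow, eval_X, eval_sub, eval_one, mul_pow, one_div, inv_pow,
    pow_add, pow_mul']
  field_simp

lemma fact_cross (m n k : ℕ) (h : m ≤ n) : (k+m).factorial * n.factorial ≤ (k+n).factorial * m.factorial := by
  induction k with
  | zero => simp [mul_comm]
  | succ k ih =>
    rw [show k+1+m = (k+m)+1 by omega, show k+1+n = (k+n)+1 by omega, Nat.factorial_succ, Nat.factorial_succ,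
      mul_assoc, mul_assoc]
    exact Nat.mul_le_mul (by omega) ih

/-- The factor functions. -/
noncomputable def facF (p q : ℕ) (A B : ℝ → ℝ) (m : ℕ) (t : ℝ) : ℝ :=
  (if m = p then A t else 1) * (if m = q then B t else 1)

lemma facF_cont (p q : ℕ) (A B : ℝ → ℝ) (hA : Continuous A) (hB : Continuous B) (m : ℕ) :
    Continuous (facF p q A B m) := by
  unfold facF
  refine Continuous.mul ?_ ?_
  · split_ifs; exacts [hA, continuous_const]
  · split_ifs; exacts [hB, continuous_const]

lemma iterF_low (f : ℕ → ℝ → ℝ) (p : ℕ) (hf : ∀ m < p, ∀ t, f m t = 1) :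
    ∀ m ≤ p, ∀ t, iterF f m t = t^m / m.factorial := by
  intro m
  induction m with
  | zero => intro _ t; simp [iterF]
  | succ m ih =>
    intro hm t
    rw [iterF]
    have : ∀ s, f m s * iterF f m s = s^m / m.factorial := fun s => by
      rw [hf m (by omega), ih (by omega), one_mul]
    simp only [this]
    rw [intervalIntegral.integral_div, integral_pow, Nat.factorial_succ]
    push_cast
    simp
    field_simp

lemma RP_int (a b k : ℕ) (t : ℝ) :
    ∫ s in (0:ℝ)..t, s^b * (RP (a+1) b k).eval s = t^(b+1) * (RP a (b+1) k).eval t := by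
  have h := intervalIntegral.integral_eq_sub_of_hasDerivAt (a := 0) (b := t)
    (fun x _ => (Polynomial.X^(b+1) * RP a (b+1) k).hasDerivAt x)
    ((Polynomial.continuous _).intervalIntegrable _ _)
  rw [RP_deriv] at h
  simpa using h

lemma iterF_mid (f : ℕ → ℝ → ℝ) (d p q k : ℕ) (hpq : p < q) (hqd : q < d) (α : ℝ)
    (hlow : ∀ m < p, ∀ t, f m t = 1)
    (hp : ∀ t, f p t = α * (RP (d-1-p) p k).eval t) (hmid : ∀ m, p < m → m < q → ∀ t, f m t = 1) :
    ∀ m, p + 1 ≤ m → m ≤ q → ∀ t, iterF f m t = α / p.factorial * (t^m * (RP (d-1-m) m k).eval t) := by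
  intro m hm
  induction m, hm using Nat.le_induction with
  | base =>
    intro _ t
    rw [iterF]
    have : ∀ s, f p s * iterF f p s = α / p.factorial * (s^p * (RP (d-1-(p+1)+1) p k).eval s) := fun s => by
      rw [hp, iterF_low f p hlow p le_rfl, show d-1-(p+1)+1 = d-1-p by omega]; ring
    simp only [this]
    rw [intervalIntegral.integral_const_mul, RP_int]
  | succ m hm ih =>
    intro hq t
    rw [iterF]
    have : ∀ s, f m s * iterF f m s = α / p.factorial * (s^m * (RP (d-1-(m+1)+1) m k).eval s) := fun s => by
      rw [hmid m (by omega) (by omega), ih (by omega), show d-1-(m+1)+1 = d-1-m by omega]; ring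
    simp only [this]
    rw [intervalIntegral.integral_const_mul, RP_int]

lemma iterF_high (f : ℕ → ℝ → ℝ) (hf : ∀ m, Continuous (f m)) (q : ℕ)
    (n : ℕ) : ∀ N, (∀ m, q < m → ∀ t, f m t = 1) → q + n + 1 = N → ∀ r ≤ n,
    iterF f N 1 = ∫ s in (0:ℝ)..1, (1-s)^r / r.factorial * (f (q+n-r) s * iterF f (q+n-r) s) := by
  intro N hhigh hN r
  subst hN
  induction r with
  | zero => intro _; simp [iterF]
  | succ r ih =>
    intro hr
    rw [ih (by omega)]
    obtain ⟨M, hM⟩ : ∃ M, M + 1 = q + n - r := ⟨q+n-r-1, by omega⟩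
    rw [← hM, show q + n - (r+1) = M by omega]
    have hc : Continuous (fun s => f M s * iterF f M s) := (hf M).mul (iterF_cont f hf M)
    have := intervalIntegral.integral_mul_deriv_eq_deriv_mul (a := 0) (b := 1)
      (u := fun x : ℝ => iterF f (M+1) x) (v := fun x => -((1-x)^(r+1)/(r+1).factorial)) 
      (u' := fun x => f M x * iterF f M x)
      (v' := fun x => (1-x)^r / r.factorial)
      (fun x _ => hc.integral_hasStrictDerivAt 0 x |>.hasDerivAt)
      (fun x _ => by
        have := ((((hasDerivAt_id x).const_sub 1).pow (r+1)).div_const ((r+1).factorial:ℝ)).neg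
        refine this.congr_deriv ?_; rw [Nat.factorial_succ]; push_cast; simp; field_simp)
      (hc.intervalIntegrable _ _)
      ((by fun_prop : Continuous _).intervalIntegrable _ _)
    have e : ∀ s, (1-s)^r / r.factorial * (f (M+1) s * iterF f (M+1) s) =
        iterF f (M+1) s * ((1-s)^r / r.factorial) := fun s => by
      rw [hhigh (M+1) (by omega)]; ring
    simp only [e]
    rw [this]
    have : iterF f (M+1) 0 = 0 := by simp [iterF]
    rw [this, sub_self, zero_pow (by omega), zero_div, neg_zero, mul_zero, zero_mul, sub_zero, zero_sub,
      ← intervalIntegral.integral_neg]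
    congr 1; funext s; ring

lemma main_integral (d p q k l : ℕ) (hpq : p < q) (hqd : q < d) (α β : ℝ) :
    ∫ x in simplexD d, (α * (RP (d-1-p) p k).eval (x ⟨p, by omega⟩)) * (β * (RP (d-1-q) q l).eval (x ⟨q, hqd⟩))
     = α * β / (p.factorial * (d-1-q).factorial) *
      if k = l then (k.factorial * (d-1-q+k).factorial : ℝ) / ((2*k+d) * (d-1+k).factorial * (q+k).factorial) else 0 := by
  set f := facF p q (fun t => α * (RP (d-1-p) p k).eval t) (fun t => β * (RP (d-1-q) q l).eval t) with hfdef
  have hf : ∀ m, Continuous (f m) := facF_cont _ _ _ _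
    (continuous_const.mul (Polynomial.continuous _)) (continuous_const.mul (Polynomial.continuous _))
  have h1 := simplex_integral f hf d 1 zero_le_one
  have e1 : ∀ x : Fin d → ℝ, ∏ m : Fin d, f m (x m) =
      (α * (RP (d-1-p) p k).eval (x ⟨p, by omega⟩)) * (β * (RP (d-1-q) q l).eval (x ⟨q, hqd⟩)) := by
    intro x
    simp only [hfdef, facF]
    rw [Finset.prod_mul_distrib]
    congr 1
    · rw [Finset.prod_eq_single ⟨p, by omega⟩]
      · simp
      · intro b _ hb; rw [if_neg (fun h => hb (Fin.ext h))]
      · simp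
    · rw [Finset.prod_eq_single ⟨q, hqd⟩]
      · simp
      · intro b _ hb; rw [if_neg (fun h => hb (Fin.ext h))]
      · simp
  simp only [e1] at h1
  refine Eq.trans h1 ?_
  have hone : ∀ m, m ≠ p → m ≠ q → ∀ t, f m t = 1 := fun m hp hq t => by simp [hfdef, facF, hp, hq]
  rw [iterF_high f hf q (d-1-q) d (fun m hm => hone m (by omega) (by omega)) (by omega) (d-1-q) le_rfl,
    show q + (d-1-q) - (d-1-q) = q by omega]
  have hm := iterF_mid f d p q k hpq hqd α (fun m hm => hone m (by omega) (by omega))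
    (fun t => by simp [hfdef, facF, hpq.ne]) (fun m h1 h2 => hone m (by omega) (by omega)) q hpq le_rfl
  have e2 : ∀ s : ℝ, (1-s)^(d-1-q) / (d-1-q).factorial * (f q s * iterF f q s) =
     α * β / (p.factorial * (d-1-q).factorial) *
      (s^q * (1-s)^(d-1-q) * (RP (d-1-q) q k).eval s * (RP (d-1-q) q l).eval s) := fun s => by
    rw [hm]
    simp only [hfdef, facF, hpq.ne', if_false, if_true]
    field_simp
  simp only [e2]
  rw [intervalIntegral.integral_const_mul, RP_orth]
  congr 2
  rw [show d-1-q+q+k = d-1+k by omega]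
  have : (2*k + ((d-1-q : ℕ):ℝ) + q + 1) = 2*k+d := by
    have : (((d-1-q)+q+1 : ℕ):ℝ) = d := by congr 1; omega
    push_cast at this; linarith
  rw [this]

lemma phi_coef (N pi ri pj rj Di Ii Dj Ij K M E : ℝ) (hN : N = E * K * M) (h1 : 0 < pi) (h2 : 0 < ri)
    (h3 : 0 < pj) (h4 : 0 < rj) (h5 : 0 < Di) (h6 : 0 < Ii) (h7 : 0 < Dj) (h8 : 0 < Ij) (hK : 0 < K) (hM : 0 < M)
    (hE : 0 < E) :
    (√(N/(pi*ri)) * √(Di*Ii) * (ri/K)) * (√(N/(pj*rj)) * √(Dj*Ij) * (rj/K)) / (Ii * Dj)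
      * ((K*pj)/(E*M*rj)) = √((Ij*Di)/(Ii*Dj)) * √((pj*ri)/(pi*rj)) := by
  have hNp : 0 < N := by rw [hN]; positivity
  have hL : 0 ≤ (√(N/(pi*ri)) * √(Di*Ii) * (ri/K)) * (√(N/(pj*rj)) * √(Dj*Ij) * (rj/K)) / (Ii * Dj)
      * ((K*pj)/(E*M*rj)) := by positivity
  refine (sq_eq_sq₀ hL (by positivity)).1 ?_
  simp only [mul_pow, div_pow]
  repeat rw [Real.sq_sqrt (by positivity)]
  rw [hN]
  field_simp

lemma phiB_eq (d i k : ℕ) (t : ℝ) (h0 : t ≠ 0) (h1 : t ≠ 1) :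
    phiB d i k t = ((-1)^k * (Real.sqrt ((((2*k+d) * k.factorial * (k+d-1).factorial : ℕ) : ℝ) /
      (((k+d-i).factorial * (k+i-1).factorial : ℕ) : ℝ)) *
      Real.sqrt (((d-i).factorial * (i-1).factorial : ℕ) : ℝ) * ((i-1+k).factorial / k.factorial))) *
      (RP (d-i) (i-1) k).eval t := by
  rw [phiB, jacobiP_eq _ _ _ _ h0 h1]; ring

lemma main_le_one (d i j : ℕ) (h1 : 1 ≤ i) (hij : i < j) (hjd : j ≤ d) (k : ℕ) :
    Real.sqrt ((((j-1).factorial * (d-i).factorial : ℕ) : ℝ) /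
            (((i-1).factorial * (d-j).factorial : ℕ) : ℝ)) *
          Real.sqrt ((((k+d-j).factorial * (k+i-1).factorial : ℕ) : ℝ) /
            (((k+d-i).factorial * (k+j-1).factorial : ℕ) : ℝ)) ≤ 1 := by
  rw [← Real.sqrt_mul (by positivity), Real.sqrt_le_iff, and_iff_right zero_le_one, one_pow, div_mul_div_comm, div_le_one (by positivity)]
  have a := fact_cross (i-1) (j-1) k (by omega)
  have b := fact_cross (d-j) (d-i) k (by omega)
  rw [show k+d-j = k+(d-j) by omega, show k+d-i = k+(d-i) by omega, show k+i-1 = k+(i-1) by omega,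
    show k+j-1 = k+(j-1) by omega]
  have := Nat.mul_le_mul a b
  have : ((j-1).factorial * (d-i).factorial) * ((k+(d-j)).factorial * (k+(i-1)).factorial) ≤
    ((i-1).factorial * (d-j).factorial) * ((k+(d-i)).factorial * (k+(j-1)).factorial) := by
    convert this using 1 <;> ring
  exact_mod_cast this

/-- Mixed scalar products of the basis polynomials on the simplex. -/
theorem statement7 (d i j : ℕ) (hd : 2 ≤ d) (h1 : 1 ≤ i) (hij : i < j) (hjd : j ≤ d)
    (k l : ℕ) :
    (∫ x in simplexD d, phiB d i k (x ⟨i-1, by omega⟩) * phiB d j l (x ⟨j-1, by omega⟩))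
      = (if k = l then
          Real.sqrt ((((j-1).factorial * (d-i).factorial : ℕ) : ℝ) /
            (((i-1).factorial * (d-j).factorial : ℕ) : ℝ)) *
          Real.sqrt ((((k+d-j).factorial * (k+i-1).factorial : ℕ) : ℝ) /
            (((k+d-i).factorial * (k+j-1).factorial : ℕ) : ℝ))
        else 0) ∧
    0 ≤ (∫ x in simplexD d, phiB d i k (x ⟨i-1, by omega⟩) * phiB d j l (x ⟨j-1, by omega⟩)) ∧
    (∫ x in simplexD d, phiB d i k (x ⟨i-1, by omega⟩) * phiB d j l (x ⟨j-1, by omega⟩)) ≤ 1 := by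
  have key : (∫ x in simplexD d, phiB d i k (x ⟨i-1, by omega⟩) * phiB d j l (x ⟨j-1, by omega⟩))
      = (if k = l then
          Real.sqrt ((((j-1).factorial * (d-i).factorial : ℕ) : ℝ) /
            (((i-1).factorial * (d-j).factorial : ℕ) : ℝ)) *
          Real.sqrt ((((k+d-j).factorial * (k+i-1).factorial : ℕ) : ℝ) /
            (((k+d-i).factorial * (k+j-1).factorial : ℕ) : ℝ))
        else 0) := by
    have hne : ∀ (m : Fin d) (c : ℝ), ∀ᵐ x : Fin d → ℝ, x m ≠ c := fun m c => by
      rw [volume_pi]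
      exact compl_mem_ae_iff.2 (Measure.pi_hyperplane (fun _ : Fin d => (volume : Measure ℝ)) m c)
    have hmain := main_integral d (i-1) (j-1) k l (by omega) (by omega)
      ((-1)^k * (Real.sqrt ((((2*k+d) * k.factorial * (k+d-1).factorial : ℕ) : ℝ) /
      (((k+d-i).factorial * (k+i-1).factorial : ℕ) : ℝ)) *
      Real.sqrt (((d-i).factorial * (i-1).factorial : ℕ) : ℝ) * ((i-1+k).factorial / k.factorial)))
      ((-1)^l * (Real.sqrt ((((2*l+d) * l.factorial * (l+d-1).factorial : ℕ) : ℝ) /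
      (((l+d-j).factorial * (l+j-1).factorial : ℕ) : ℝ)) *
      Real.sqrt (((d-j).factorial * (j-1).factorial : ℕ) : ℝ) * ((j-1+l).factorial / l.factorial)))
    rw [show d-1-(i-1) = d-i by omega, show d-1-(j-1) = d-j by omega] at hmain
    have hcong : (∫ x in simplexD d, phiB d i k (x ⟨i-1, by omega⟩) * phiB d j l (x ⟨j-1, by omega⟩)) = _ :=
      integral_congr_ae (by
        refine ae_restrict_of_ae ?_
        filter_upwards [hne ⟨i-1, by omega⟩ 0, hne ⟨i-1, by omega⟩ 1, hne ⟨j-1, by omega⟩ 0,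
          hne ⟨j-1, by omega⟩ 1] with x a1 a2 a3 a4
        exact congrArg₂ (· * ·) (phiB_eq d i k _ a1 a2) (phiB_eq d j l _ a3 a4))
    rw [hcong]
    refine hmain.trans ?_
    split_ifs with hk
    · subst hk
      have hs : ((-1:ℝ)^k)*(-1)^k = 1 := by rw [← mul_pow]; simp
      have := phi_coef (((2*k+d) * k.factorial * (k+d-1).factorial : ℕ) : ℝ) (k+d-i).factorial (k+i-1).factorial
        (k+d-j).factorial (k+j-1).factorial (d-i).factorial (i-1).factorial (d-j).factorial (j-1).factorial
        k.factorial (k+d-1).factorial (2*k+d) (by push_cast; ring) (by positivity) (by positivity) (by positivity)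
        (by positivity) (by positivity) (by positivity) (by positivity) (by positivity) (by positivity) (by positivity)
        (by positivity)
      rw [show i-1+k = k+i-1 by omega, show j-1+k = k+j-1 by omega, show d-j+k = k+d-j by omega,
        show d-1+k = k+d-1 by omega]
      simp only [Nat.cast_mul (Nat.factorial _)]
      rw [← this]
      linear_combination (((√((((2*k+d) * k.factorial * (k+d-1).factorial : ℕ) : ℝ)/((k+d-i).factorial*(k+i-1).factorial)) * √((d-i).factorial*(i-1).factorial) * ((k+i-1).factorial/k.factorial)) * (√((((2*k+d) * k.factorial * (k+d-1).factorial : ℕ) : ℝ)/((k+d-j).factorial*(k+j-1).factorial)) * √((d-j).factorial*(j-1).factorial) * ((k+j-1).factorial/k.factorial)) / ((i-1).factorial * (d-j).factorial)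
      * ((k.factorial*(k+d-j).factorial)/((2*k+d)*(k+d-1).factorial*(k+j-1).factorial)))) * hs
    · simp
  refine ⟨key, ?_, ?_⟩ <;> rw [key] <;> split_ifs
  · positivity
  · exact le_rfl
  · exact main_le_one d i j h1 hij hjd k
  · exact zero_le_one
end

section
/- For k ∈ ℕ*, let R_k be the d×d matrix with entries R_k(i,j) = ∫_△ φ_{i,k}(x_i) φ_{j,k}(x_j) dx. Then the smallest eigenvalue of R_k equals k/(k+d-1), and in particular it is at least 1/d. -/
open MeasureTheory Real

/-- ratio-type sums -/
lemma aux_Rsum (d : ℕ) (u X : ℕ → ℝ) (i : ℕ) (hi : i < d) :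
    ∑ j ∈ Finset.range d, (u (min i j) / u (max i j)) * X j =
      u i * (∑ j ∈ Finset.Ico i d, X j / u j) + (∑ j ∈ Finset.range i, u j * X j) / u i := by
  rw [← Finset.sum_range_add_sum_Ico _ hi.le, add_comm, Finset.mul_sum, Finset.sum_div]
  congr 1
  · refine Finset.sum_congr rfl fun j hj => ?_
    rw [Finset.mem_Ico] at hj
    rw [min_eq_left hj.1, max_eq_right hj.1]; ring
  · refine Finset.sum_congr rfl fun j hj => ?_
    rw [Finset.mem_range] at hj
    rw [min_eq_right hj.le, max_eq_left hj.le]; ring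

lemma aux_quad (d k : ℕ) (hd : 2 ≤ d) (hk : 1 ≤ k) (s S : ℕ → ℝ) (hs : ∀ i, 0 < s i)
    (hrec : ∀ m, m + 1 < d → s (m+1) * ((d - 1 - m) * (m+1)) = s m * ((k + d - 1 - m) * (k + m + 1)))
    (hS : S d = 0) :
    (k:ℝ)/(k+d-1) * ∑ i ∈ Finset.range d, s i * (S i - S (i+1))^2 ≤
      ∑ i ∈ Finset.range d, (S i - S (i+1)) * (s i * S i + ∑ j ∈ Finset.range i, s j * (S j - S (j+1))) := by
  have hk' : (1:ℝ) ≤ k := by exact_mod_cast hk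
  have hd' : (2:ℝ) ≤ d := by exact_mod_cast hd
  set lam := (k:ℝ)/(k+d-1) with hlam
  have key : ∀ D, D + 1 ≤ d →
      -(S D * ∑ j ∈ Finset.range D, s j * (S j - S (j+1))) - s D * (D / (k + D)) * S D ^ 2 ≤
      ∑ i ∈ Finset.range D, (S i - S (i+1)) * (s i * S i + ∑ j ∈ Finset.range i, s j * (S j - S (j+1)))
       - lam * ∑ i ∈ Finset.range D, s i * (S i - S (i+1))^2 := by
    intro D
    induction D with
    | zero => intro _; simp
    | succ D ih =>
      intro hD
      have ih := ih (by omega)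
      simp only [Finset.sum_range_succ] at ih ⊢
      set Q := ∑ j ∈ Finset.range D, s j * (S j - S (j+1))
      have h := hrec D (by omega)
      have hDd : (D:ℝ) + 2 ≤ d := by exact_mod_cast hD
      have hD0 : (0:ℝ) ≤ D := by positivity
      have e1 : s (D+1) = s D * ((k + d - 1 - D) * (k + D + 1)) / ((d - 1 - D) * (D+1)) := by
        rw [eq_div_iff]; exact h
        have : (0:ℝ) < (d - 1 - D) := by linarith
        positivity
      have e2 : s (D+1) * (((D+1:ℕ):ℝ) / (k + ((D+1:ℕ):ℝ))) = s D * ((k + d - 1 - D) / (d - 1 - D)) := by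
        have : (d:ℝ) - 1 - D ≠ 0 := by linarith
        rw [e1]; push_cast; field_simp; ring
      rw [e2]
      have c0 : (0:ℝ) < (d - 1 - D) := by linarith
      have ck : (0:ℝ) < k + D := by linarith
      have cl : (0:ℝ) < k + d - 1 := by linarith
      have e3 : (S D - S (D+1)) * (s D * S D + Q) - lam * (s D * (S D - S (D+1))^2)
         = S D * Q + s D * (D / (k + D)) * S D ^ 2 - S (D+1) * (Q + s D * (S D - S (D+1)))
            - s D * ((k + d - 1 - D) / (d - 1 - D)) * S (D+1)^2
            + s D * k / ((k + d - 1) * (k + D) * (d - 1 - D)) * ((d - 1 - D) * S D + (k + D) * S (D+1))^2 := by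
        rw [hlam]; field_simp; ring
      have e4 : 0 ≤ s D * k / ((k + d - 1) * (k + D) * (d - 1 - D)) * ((d - 1 - D) * S D + (k + D) * S (D+1))^2 := by
        have := hs D
        positivity
      linarith
  obtain ⟨D, rfl⟩ : ∃ D, d = D + 1 := ⟨d - 1, by omega⟩
  have kk := key D le_rfl
  rw [Finset.sum_range_succ, Finset.sum_range_succ, hS]
  have : lam * (s D * (S D - 0)^2) = s D * S D^2 - s D * (D / (k+D)) * S D^2 := by
    rw [hlam]; push_cast; 
    have ck : (0:ℝ) < k + D := by positivity
    have : (k:ℝ) + (D + 1) - 1 = k + D := by ring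
    rw [this]; field_simp; ring
  rw [mul_add, this]
  linarith

theorem aux_linalg (d k : ℕ) (hd : 2 ≤ d) (hk : 1 ≤ k) (u : ℕ → ℝ) (hu : ∀ i, 0 < u i)
    (hrec : ∀ m, m + 1 < d → u (m+1)^2 * ((d - 1 - m) * (m+1)) = u m ^2 * ((k + d - 1 - m) * (k + m + 1)))
    (R : Matrix (Fin d) (Fin d) ℝ)
    (hR : ∀ i j : Fin d, R i j = u (min i.1 j.1) / u (max i.1 j.1)) :
    Module.End.HasEigenvalue (Matrix.toLin' R) ((k:ℝ)/(k+d-1)) ∧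
    (∀ μ : ℝ, Module.End.HasEigenvalue (Matrix.toLin' R) μ → (k:ℝ)/(k+d-1) ≤ μ) ∧
    (1:ℝ)/d ≤ (k:ℝ)/(k+d-1) := by
  have hk' : (1:ℝ) ≤ k := by exact_mod_cast hk
  have hd' : (2:ℝ) ≤ d := by exact_mod_cast hd
  have cl : (0:ℝ) < k + d - 1 := by linarith
  have hmul : ∀ (X : ℕ → ℝ) (i : Fin d), R.mulVec (fun j => X j.1) i =
      u i * (∑ j ∈ Finset.Ico i.1 d, X j / u j) + (∑ j ∈ Finset.range i.1, u j * X j) / u i := by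
    intro X i
    rw [← aux_Rsum d u X i.1 i.2, Matrix.mulVec, dotProduct, Finset.sum_range]
    exact Finset.sum_congr rfl fun j _ => by rw [hR]
  refine ⟨?_, ?_, ?_⟩
  · let S : ℕ → ℝ := fun m => ∏ l ∈ Finset.range m, (-((d - 1 - l) / (k + l)) : ℝ)
    have hS0 : S 0 = 1 := by simp [S]
    have hSs : ∀ m, S (m+1) = S m * -((d - 1 - m) / (k + m)) := fun m => by
      simp [S, Finset.prod_range_succ]
    have hSd : S d = 0 := by
      obtain ⟨D, rfl⟩ : ∃ D, d = D + 1 := ⟨d - 1, by omega⟩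
      rw [hSs]; simp
    have hQ : ∀ i, i + 1 ≤ d → ∑ j ∈ Finset.range i, u j ^ 2 * (S j - S (j+1)) = - (u i ^2 * S i * (i / (k + i))) := by
      intro i
      induction i with
      | zero => simp
      | succ i ih =>
        intro hi
        rw [Finset.sum_range_succ, ih (by omega), hSs]
        have h := hrec i (by omega)
        have hDd : (i:ℝ) + 2 ≤ d := by exact_mod_cast hi
        have c0 : (0:ℝ) < (d - 1 - i) := by linarith
        have e1 : u (i+1)^2 = u i^2 * ((k + d - 1 - i) * (k + i + 1)) / ((d - 1 - i) * (i+1)) := by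
          rw [eq_div_iff]; exact h
          positivity
        rw [e1]; push_cast; field_simp; ring
    have hsuf : ∀ i, i ≤ d → ∑ j ∈ Finset.Ico i d, (S j - S (j+1)) = S i := by
      intro i hi
      rw [Finset.sum_Ico_eq_sub _ hi, Finset.sum_range_sub', Finset.sum_range_sub', hSd]; ring
    let X : ℕ → ℝ := fun j => u j * (S j - S (j+1))
    apply Module.End.hasEigenvalue_of_hasEigenvector (x := fun j : Fin d => X j.1)
    rw [Module.End.hasEigenvector_iff, Module.End.mem_eigenspace_iff]
    constructor
    · rw [Matrix.toLin'_apply]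
      ext i
      rw [hmul X i]
      have h1 : ∑ j ∈ Finset.Ico i.1 d, X j / u j = S i := by
        rw [← hsuf i i.2.le]
        refine Finset.sum_congr rfl fun j _ => ?_
        have := (hu j).ne'
        simp only [X]; field_simp
      have h2 : ∑ j ∈ Finset.range i.1, u j * X j = - (u i ^2 * S i * (i / (k + i))) := by
        rw [← hQ i i.2]
        refine Finset.sum_congr rfl fun j _ => ?_
        simp only [X]; ring
      rw [h1, h2]
      simp only [X, Pi.smul_apply, smul_eq_mul]
      rw [hSs]
      have := (hu i).ne'
      have ck : (0:ℝ) < k + (i.1:ℝ) := by positivity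
      field_simp
      ring
    · intro h
      have h0 := congrFun h ⟨0, by omega⟩
      simp only [X, Pi.zero_apply] at h0
      rw [hSs, hS0] at h0
      have := hu 0
      have h3 : (0:ℝ) < 1 - 1 * -((d - 1 - (0:ℕ)) / (k + (0:ℕ))) := by
        have : (0:ℝ) ≤ (d - 1 - (0:ℕ)) / (k + (0:ℕ)) := by
          apply div_nonneg <;> push_cast <;> linarith
        linarith
      have := mul_pos this h3
      linarith
  · intro μ hμ
    obtain ⟨x, hx⟩ := hμ.exists_hasEigenvector
    rw [Module.End.hasEigenvector_iff, Module.End.mem_eigenspace_iff, Matrix.toLin'_apply] at hx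
    obtain ⟨hx, hx0⟩ := hx
    let X : ℕ → ℝ := fun j => if h : j < d then x ⟨j, h⟩ else 0
    have hX : x = fun j : Fin d => X j.1 := by ext j; simp [X]
    let S : ℕ → ℝ := fun m => ∑ j ∈ Finset.Ico m d, X j / u j
    have hSd : S d = 0 := by simp [S]
    have hdiff : ∀ i, i < d → S i - S (i+1) = X i / u i := by
      intro i hi
      simp only [S]; rw [Finset.sum_eq_sum_Ico_succ_bot hi]; ring
    have hq := aux_quad d k hd hk (fun i => u i ^2) S (fun i => by have := hu i; positivity) hrec hSd
    have h1 : ∑ i ∈ Finset.range d, u i ^ 2 * (S i - S (i+1))^2 = ∑ i, x i ^ 2 := by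
      rw [Finset.sum_range]
      refine Finset.sum_congr rfl fun i _ => ?_
      rw [hdiff i i.2, hX]
      have := (hu i).ne'
      field_simp
    have h2 : ∑ i ∈ Finset.range d, (S i - S (i+1)) * (u i ^2 * S i + ∑ j ∈ Finset.range i, u j ^2 * (S j - S (j+1)))
        = μ * ∑ i, x i ^ 2 := by
      rw [Finset.sum_range, Finset.mul_sum]
      refine Finset.sum_congr rfl fun i _ => ?_
      have h3 := congrFun hx i
      have e : R.mulVec x i = R.mulVec (fun j : Fin d => X j.1) i := by rw [← hX]
      rw [e, hmul X i] at h3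
      have h4 : ∑ j ∈ Finset.range i.1, u j ^2 * (S j - S (j+1)) = ∑ j ∈ Finset.range i.1, u j * X j := by
        refine Finset.sum_congr rfl fun j hj => ?_
        rw [hdiff j (by have := Finset.mem_range.1 hj; omega)]
        have := (hu j).ne'
        field_simp
      rw [h4, hdiff i i.2]
      have e5 : x i = X i := by rw [hX]
      simp only [Pi.smul_apply, smul_eq_mul, e5] at h3
      have := (hu i).ne'
      rw [e5]
      calc _ = X i * (u i * S i + (∑ j ∈ Finset.range i.1, u j * X j) / u i) := by field_simp
        _ = _ := by rw [show S i = ∑ j ∈ Finset.Ico i.1 d, X j / u j from rfl, h3]; ring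
    rw [h1, h2] at hq
    refine le_of_mul_le_mul_right hq ?_
    obtain ⟨i, hi⟩ := Function.ne_iff.1 hx0
    refine Finset.sum_pos' (fun i _ => sq_nonneg _) ⟨i, Finset.mem_univ _, ?_⟩
    exact sq_pos_of_ne_zero hi
  · rw [div_le_div_iff₀ (by linarith) cl]
    nlinarith


lemma aux_alt_poly (k : ℕ) (P : Polynomial ℝ) (hP : P.natDegree < k) :
    ∑ n ∈ Finset.range (k+1), (-1:ℝ)^n * (k.choose n) * P.eval (n:ℝ) = 0 := by
  have h := congrFun (Polynomial.fwdDiff_iter_eq_zero_of_degree_lt hP) 0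
  rw [fwdDiff_iter_eq_sum_shift] at h
  simp only [Pi.zero_apply, zero_add, nsmul_eq_mul, mul_one, zsmul_eq_mul] at h
  have h2 : (-1:ℝ)^k * ∑ n ∈ Finset.range (k+1), (-1:ℝ)^n * (k.choose n) * P.eval (n:ℝ) = 0 := by
    rw [← h, Finset.mul_sum]
    refine Finset.sum_congr rfl fun n hn => ?_
    have hn : n ≤ k := by have := Finset.mem_range.1 hn; omega
    obtain ⟨l, rfl⟩ := Nat.exists_eq_add_of_le hn
    push_cast
    rw [Nat.add_sub_cancel_left, pow_add]
    have : (-1:ℝ)^n * (-1)^n = 1 := by rw [← mul_pow]; simp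
    linear_combination (-1:ℝ)^l * ((n+l).choose n) * P.eval (n:ℝ) * this
  exact (mul_eq_zero.1 h2).resolve_left (by simp)

lemma aux_fwd_inv (k N : ℕ) (hN : 1 ≤ N) (y : ℕ) :
    (fwdDiff 1)^[k] (fun n : ℕ => (1:ℝ) / (n + N)) y =
      (-1)^k * k.factorial * ((y + N - 1).factorial : ℝ) / ((y + N + k).factorial : ℝ) := by
  obtain ⟨M, rfl⟩ : ∃ M, N = M + 1 := ⟨N - 1, by omega⟩
  have e (y : ℕ) : y + (M + 1) - 1 = y + M := by omega
  simp only [e]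
  induction k generalizing y with
  | zero =>
    simp only [Function.iterate_zero, id, ← add_assoc, add_zero, Nat.factorial_succ]
    have := Nat.factorial_pos (y+M)
    push_cast
    field_simp
    simp
    ring
  | succ k ih =>
    rw [Function.iterate_succ_apply', fwdDiff, ih, ih]
    have e1 : y + 1 + M = y + M + 1 := by ring
    have e2 : y + 1 + (M+1) + k = y + M + k + 1 + 1 := by ring
    have e3 : y + (M+1) + k = y + M + k + 1 := by ring
    have e4 : y + (M+1) + (k+1) = y + M + k + 1 + 1 := by ring
    rw [e1, e2, e3, e4, Nat.factorial_succ (y+M), Nat.factorial_succ (y+M+k+1), Nat.factorial_succ k]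
    have := Nat.factorial_pos (y+M+k+1)
    push_cast
    field_simp
    ring

lemma aux_alt_inv (k N : ℕ) (hN : 1 ≤ N) :
    ∑ n ∈ Finset.range (k+1), (-1:ℝ)^n * (k.choose n) * (1 / (n + N)) =
      k.factorial * ((N - 1).factorial : ℝ) / ((N + k).factorial : ℝ) := by
  have h := aux_fwd_inv k N hN 0
  rw [fwdDiff_iter_eq_sum_shift] at h
  simp only [zero_add, nsmul_eq_mul, mul_one, zsmul_eq_mul] at h
  have h2 : (-1:ℝ)^k * ∑ n ∈ Finset.range (k+1), (-1:ℝ)^n * (k.choose n) * (1 / (n + N)) = 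
     (-1)^k * (k.factorial * ((N - 1).factorial : ℝ) / ((N + k).factorial : ℝ)) := by
    rw [← mul_div_assoc, ← mul_assoc, ← h, Finset.mul_sum]
    refine Finset.sum_congr rfl fun n hn => ?_
    have hn : n ≤ k := by have := Finset.mem_range.1 hn; omega
    obtain ⟨l, rfl⟩ := Nat.exists_eq_add_of_le hn
    push_cast
    rw [Nat.add_sub_cancel_left, pow_add]
    have : (-1:ℝ)^n * (-1)^n = 1 := by rw [← mul_pow]; simp
    linear_combination (-1:ℝ)^l * ((n+l).choose n) * (1 / (n + N)) * this
  exact mul_left_cancel₀ (by simp) h2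

noncomputable def auxP (m c : ℕ) : Polynomial ℝ :=
  ∏ r ∈ Finset.range m, (Polynomial.X + Polynomial.C ((c:ℝ) + 1 + r))

lemma auxP_deg (m c : ℕ) : (auxP m c).natDegree ≤ m := by
  refine (Polynomial.natDegree_prod_le _ _).trans ?_
  simp only [Polynomial.natDegree_X_add_C]
  simp

lemma auxP_eval (m c n : ℕ) : (auxP m c).eval (n:ℝ) = ((n+c+m).factorial : ℝ) / (n+c).factorial := by
  rw [eq_div_iff (by positivity)]
  induction m with
  | zero => simp [auxP]
  | succ m ih =>
    have : (auxP (m+1) c) = auxP m c * (Polynomial.X + Polynomial.C ((c:ℝ) + 1 + m)) := by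
      simp [auxP, Finset.prod_range_succ]
    rw [this, Polynomial.eval_mul, ← add_assoc, Nat.factorial_succ]
    push_cast
    rw [← ih]
    simp; ring

lemma auxP_eval_neg (k c e : ℕ) : (auxP k c).eval (-((k + (c + 1 + e) : ℕ):ℝ)) =
    (-1)^k * ((k + e).factorial : ℝ) / e.factorial := by
  have : ∀ m : ℕ, m ≤ k → (auxP m c).eval (-((k + (c + 1 + e) : ℕ):ℝ)) * ((k + e - m).factorial : ℝ) =
      (-1)^m * ((k+e).factorial : ℝ) := by
    intro m
    induction m with
    | zero => intro _; simp [auxP]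
    | succ m ih =>
      intro hm
      have h := ih (by omega)
      have : (auxP (m+1) c) = auxP m c * (Polynomial.X + Polynomial.C ((c:ℝ) + 1 + m)) := by
        simp [auxP, Finset.prod_range_succ]
      rw [this, Polynomial.eval_mul]
      have e1 : k + e - m = (k + e - (m+1)) + 1 := by omega
      rw [e1, Nat.factorial_succ] at h
      have e2 : ((k + e - (m+1) : ℕ) : ℝ) = k + e - (m + 1) := by
        rw [Nat.cast_sub (by omega)]; push_cast; ring
      push_cast at h
      rw [e2] at h
      simp only [Polynomial.eval_add, Polynomial.eval_X, Polynomial.eval_C]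
      push_cast
      rw [pow_succ]
      linear_combination -h
  have h := this k le_rfl
  rw [Nat.add_sub_cancel_left] at h
  rw [eq_div_iff (by positivity), h]

lemma aux_inner_zero (d k j m : ℕ) (hm : m < k) :
    ∑ n ∈ Finset.range (k+1), (-1:ℝ)^n * (k.choose n) *
      (((d + k + n).factorial : ℝ) / (j + n).factorial * ((n+m+j).factorial / (n+m+d+1).factorial)) = 0 := by
  rw [← aux_alt_poly k (auxP m j * auxP (k - 1 - m) (m+d+1)) ?_]
  · refine Finset.sum_congr rfl fun n hn => ?_
    rw [Polynomial.eval_mul, auxP_eval, auxP_eval]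
    have e1 : n + (m+d+1) + (k-1-m) = d + k + n := by omega
    have e2 : n + j + m = n + m + j := by ring
    have e3 : n + (m+d+1) = n + m + d + 1 := by ring
    rw [e1, e2, e3, add_comm j n]
    ring
  · refine Polynomial.natDegree_mul_le.trans_lt ?_
    have := auxP_deg m j
    have := auxP_deg (k-1-m) (m+d+1)
    omega

lemma aux_inner_top (d k j : ℕ) (hj : j ≤ d) :
    ∑ n ∈ Finset.range (k+1), (-1:ℝ)^n * (k.choose n) *
      (((d + k + n).factorial : ℝ) / (j + n).factorial * ((n+k+j).factorial / (n+k+d+1).factorial)) =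
      (-1)^k * ((k + (d - j)).factorial : ℝ) / (d-j).factorial *
       (k.factorial * ((k + d).factorial : ℝ) / ((2 * k + d + 1).factorial : ℝ)) := by
  obtain ⟨e, rfl⟩ := Nat.exists_eq_add_of_le hj
  rw [Nat.add_sub_cancel_left]
  rcases Nat.eq_zero_or_pos k with rfl | hk
  · have h1 := Nat.factorial_pos j
    have h2 := Nat.factorial_pos (j + e)
    have h3 := Nat.factorial_pos (j + e + 1)
    have h4 := Nat.factorial_pos e
    simp
    field_simp
  set N := k + (j + 1 + e) with hN
  have hinv := aux_alt_inv k N (by omega)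
  -- division with remainder
  let P := auxP k j
  let Q := P /ₘ (Polynomial.X - Polynomial.C (-(N:ℝ)))
  have hQ : ∀ x : ℝ, P.eval x = (x + N) * Q.eval x + P.eval (-(N:ℝ)) := by
    intro x
    have h2 : P %ₘ (Polynomial.X - Polynomial.C (-(N:ℝ))) + (Polynomial.X - Polynomial.C (-(N:ℝ))) * Q = P :=
      Polynomial.modByMonic_add_div _ _
    rw [Polynomial.modByMonic_X_sub_C_eq_C_eval] at h2
    have h3 := congrArg (Polynomial.eval x) h2
    simp at h3
    linarith
  have hdeg : Q.natDegree < k := by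
    have : Q.natDegree = P.natDegree - 1 := by
      rw [Polynomial.natDegree_divByMonic _ (Polynomial.monic_X_sub_C _), Polynomial.natDegree_X_sub_C]
    have h : P.natDegree ≤ k := auxP_deg k j
    omega
  have hzero := aux_alt_poly k Q hdeg
  have hPN : P.eval (-(N:ℝ)) = _ := auxP_eval_neg k j e
  rw [← hPN]
  have e0 : N - 1 = k + (j + e) := by omega
  have e1 : N + k = 2 * k + (j + e) + 1 := by omega
  rw [e0, e1] at hinv
  rw [← hinv, Finset.mul_sum, ← sub_eq_zero, ← Finset.sum_sub_distrib, ← hzero]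
  refine Finset.sum_congr rfl fun n hn => ?_
  have h1 : P.eval (n:ℝ) = _ := auxP_eval k j n
  rw [hQ n] at h1
  have e2 : n + k + (j+e) + 1 = (j + e + k + n) + 1 := by ring
  have e3 : n + k + j = n + j + k := by ring
  rw [e2, e3, Nat.factorial_succ, add_comm j n]
  have e4 : (((j + e + k + n : ℕ) + 1 : ℕ):ℝ) = n + N := by rw [hN]; push_cast; ring
  have hpos : (0:ℝ) < n + N := by rw [← e4]; positivity
  rw [Nat.cast_mul, e4]
  have e5 : (((j + e + k + n).factorial : ℝ) / (n + j).factorial * ((n+j+k).factorial / ((n + N) * (j + e + k + n).factorial)))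
     = ((n+j+k).factorial / (n + j).factorial : ℝ) / (n + N) := by
    have := Nat.factorial_pos (j + e + k + n)
    have := Nat.factorial_pos (n+j)
    field_simp
  rw [e5, ← h1]
  field_simp
  ring

lemma aux_double (d k i j : ℕ) (hj : j ≤ d) :
    ∑ n ∈ Finset.range (k+1), ∑ m ∈ Finset.range (k+1),
      ((-1:ℝ)^n * (k.choose n) * ((d + k + n).factorial / (i + n).factorial)) *
      ((-1:ℝ)^m * (k.choose m) * ((d + k + m).factorial / (j + m).factorial)) *
      (((n+i).factorial : ℝ) / (i.factorial * (n+j).factorial) * ((n+m+j).factorial / (n+m+d+1).factorial)) =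
    k.factorial * (k+d).factorial * (k+(d-j)).factorial /
      (i.factorial * (j+k).factorial * (d-j).factorial * (2*k+d+1)) := by
  rw [Finset.sum_comm]
  have : ∀ m ∈ Finset.range (k+1), ∑ n ∈ Finset.range (k+1),
      ((-1:ℝ)^n * (k.choose n) * ((d + k + n).factorial / (i + n).factorial)) *
      ((-1:ℝ)^m * (k.choose m) * ((d + k + m).factorial / (j + m).factorial)) *
      (((n+i).factorial : ℝ) / (i.factorial * (n+j).factorial) * ((n+m+j).factorial / (n+m+d+1).factorial)) =
      ((-1:ℝ)^m * (k.choose m) * ((d + k + m).factorial / (j + m).factorial) / i.factorial) *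
      ∑ n ∈ Finset.range (k+1), (-1:ℝ)^n * (k.choose n) *
      (((d + k + n).factorial : ℝ) / (j + n).factorial * ((n+m+j).factorial / (n+m+d+1).factorial)) := by
    intro m _
    rw [Finset.mul_sum]
    refine Finset.sum_congr rfl fun n _ => ?_
    rw [add_comm i n, add_comm j n]
    have := Nat.factorial_pos (n+i)
    field_simp
  rw [Finset.sum_congr rfl this, Finset.sum_range_succ, Finset.sum_eq_zero, aux_inner_top d k j hj]
  · have e : d + k + k = 2 * k + d := by ring
    rw [e, Nat.factorial_succ (2*k+d)]
    have h1 : (-1:ℝ)^k * (-1)^k = 1 := by rw [← mul_pow]; simp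
    push_cast
    simp only [Nat.choose_self, Nat.cast_one, mul_one, zero_add]
    have := Nat.factorial_pos (2*k+d)
    field_simp
    linear_combination h1
  · intro m hm
    rw [aux_inner_zero d k j m (Finset.mem_range.1 hm), mul_zero]

lemma aux_iter_eval (p : Polynomial ℝ) (k : ℕ) :
    iteratedDeriv k (fun s => p.eval s) = fun s => (Polynomial.derivative^[k] p).eval s := by
  induction k with
  | zero => simp
  | succ k ih =>
    rw [iteratedDeriv_succ, ih, Function.iterate_succ_apply']
    ext s
    simp

lemma aux_deriv (a b k : ℕ) (t : ℝ) :
    iteratedDeriv k (fun s : ℝ => (1-s)^a * (1+s)^b * (1-s^2)^k) t =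
    ∑ l ∈ Finset.range (k+1), (k.choose l : ℝ) * (((b+k).descFactorial (k-l) : ℝ) * (1+t)^(b+l) *
      ((-1)^l * ((a+k).descFactorial l : ℝ) * (1-t)^(a+k-l))) := by
  have h : (fun s : ℝ => (1-s)^a * (1+s)^b * (1-s^2)^k) =
      fun s => (((Polynomial.X + Polynomial.C 1)^(b+k) * (Polynomial.C ((-1)^(a+k)) * (Polynomial.X - Polynomial.C 1)^(a+k)) : Polynomial ℝ)).eval s := by
    ext s
    simp only [Polynomial.eval_mul, Polynomial.eval_pow, Polynomial.eval_add, Polynomial.eval_sub, Polynomial.eval_X, Polynomial.eval_C]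
    rw [← mul_pow, show (1 - s^2) = (1-s)*(1+s) by ring, mul_pow, show -1 * (s - 1) = 1 - s by ring, add_comm s 1]
    ring
  rw [h, aux_iter_eval, Polynomial.iterate_derivative_mul]
  simp only [Polynomial.eval_finsetSum]
  refine Finset.sum_congr rfl fun l hl => ?_
  have hl : l ≤ k := by have := Finset.mem_range.1 hl; omega
  rw [Polynomial.iterate_derivative_C_mul, Polynomial.iterate_derivative_X_add_pow, Polynomial.iterate_derivative_X_sub_pow]
  simp only [Polynomial.eval_mul, Polynomial.eval_pow, Polynomial.eval_add, Polynomial.eval_sub, Polynomial.eval_X, Polynomial.eval_C, nsmul_eq_mul, Polynomial.eval_natCast]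
  have e1 : b + k - (k - l) = b + l := by omega
  have e2 : (-1:ℝ)^(a+k) * (t-1)^(a+k-l) = (-1)^l * (1-t)^(a+k-l) := by
    have : a + k = l + (a+k-l) := by omega
    rw [show (1 - t) = -1 * (t-1) by ring, mul_pow]
    nth_rewrite 1 [this]
    rw [pow_add]; ring
  rw [e1, add_comm t 1]
  linear_combination (k.choose l : ℝ) * ((b+k).descFactorial (k-l) : ℝ) * (1+t)^(b+l) * ((a+k).descFactorial l : ℝ) * e2

lemma aux_vander (a b k n : ℕ) (hn : n ≤ k) :
    ∑ l ∈ Finset.range (n+1), (n.choose l : ℝ) * ((b+k).descFactorial (k-l) : ℝ) * ((a+k).descFactorial l : ℝ) =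
    (b+k).factorial * (a+b+k+n).factorial / ((b+n).factorial * (a+b+k).factorial) := by
  have hV := Nat.add_choose_eq (a+k) (b+n) n
  rw [Finset.Nat.sum_antidiagonal_eq_sum_range_succ_mk] at hV
  have e0 : a + k + (b + n) = (a + b + k) + n := by ring
  rw [e0, Nat.add_comm (a+b+k) n] at hV
  have h1 : ((n + (a+b+k)).choose n : ℝ) = (n + (a+b+k)).factorial / (n.factorial * (a+b+k).factorial) :=
    Nat.cast_add_choose ℝ
  rw [hV] at h1
  push_cast at h1
  have h2 : ((b+k).factorial * (a+b+k+n).factorial / ((b+n).factorial * (a+b+k).factorial) : ℝ) =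
     (b+k).factorial * n.factorial / (b+n).factorial * ((n + (a+b+k)).factorial / (n.factorial * (a+b+k).factorial)) := by
    rw [add_comm n (a+b+k)]
    have := Nat.factorial_pos n
    field_simp
  rw [h2, ← h1, Finset.mul_sum]
  refine Finset.sum_congr rfl fun l hl => ?_
  have hl : l ≤ n := by have := Finset.mem_range.1 hl; omega
  obtain ⟨r, rfl⟩ := Nat.exists_eq_add_of_le hl
  obtain ⟨q, rfl⟩ := Nat.exists_eq_add_of_le hn
  have f1 : ((l + r).choose l : ℝ) = (l+r).factorial / (l.factorial * r.factorial) := Nat.cast_add_choose ℝ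
  have f2 : ((b + (l+r)).choose r : ℝ) = (b+(l+r)).factorial / (r.factorial * (b+l).factorial) := by
    rw [show b + (l+r) = r + (b+l) by ring]; exact Nat.cast_add_choose ℝ
  have f3 : ((b + (l+r+q)).descFactorial (l+r+q-l) : ℝ) = (b+(l+r+q)).factorial / (b+l).factorial := by
    rw [eq_div_iff (by positivity), mul_comm]
    have := Nat.factorial_mul_descFactorial (n := b+(l+r+q)) (k := l+r+q-l) (by omega)
    rw [show b + (l+r+q) - (l+r+q-l) = b + l by omega] at this
    exact_mod_cast this
  have f4 : (((a+(l+r+q)).descFactorial l : ℕ) : ℝ) = l.factorial * (a+(l+r+q)).choose l := by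
    exact_mod_cast Nat.descFactorial_eq_factorial_mul_choose _ _
  rw [Nat.add_sub_cancel_left, f1, f2, f3, f4]
  have := Nat.factorial_pos l
  have := Nat.factorial_pos r
  have := Nat.factorial_pos (b+(l+r))
  field_simp

lemma aux_expand (a b k : ℕ) (x : ℝ) :
    ∑ l ∈ Finset.range (k+1), (k.choose l : ℝ) * (((b+k).descFactorial (k-l) : ℝ) * x^l *
      ((-1)^l * ((a+k).descFactorial l : ℝ) * (1-x)^(k-l))) =
    ∑ n ∈ Finset.range (k+1), (-1:ℝ)^n * (k.choose n) * 
      ((b+k).factorial * (a+b+k+n).factorial / ((b+n).factorial * (a+b+k).factorial)) * x^n := by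
  have h1 : ∀ l ∈ Finset.range (k+1), (k.choose l : ℝ) * (((b+k).descFactorial (k-l) : ℝ) * x^l *
      ((-1)^l * ((a+k).descFactorial l : ℝ) * (1-x)^(k-l))) =
      ∑ n ∈ Finset.Ico l (k+1), (-1:ℝ)^n * (k.choose n) * x^n * ((n.choose l : ℝ) * ((b+k).descFactorial (k-l) : ℝ) * ((a+k).descFactorial l : ℝ)) := by
    intro l hl
    have hl : l ≤ k := by have := Finset.mem_range.1 hl; omega
    have hb : (1-x)^(k-l) = ∑ r ∈ Finset.range (k-l+1), (-x)^r * ((k-l).choose r : ℝ) := by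
      rw [show (1 - x) = -x + 1 by ring, add_pow]; simp
    rw [hb, Finset.sum_Ico_eq_sum_range, show k + 1 - l = k - l + 1 by omega]
    simp only [Finset.mul_sum]
    refine Finset.sum_congr rfl fun r hr => ?_
    have hr : r ≤ k - l := by have := Finset.mem_range.1 hr; omega
    have hc : (k.choose (l+r) : ℝ) * ((l+r).choose l) = k.choose l * (k-l).choose r := by
      have := Nat.choose_mul (n := k) (k := l+r) (s := l) (by omega) 
      rw [Nat.add_sub_cancel_left] at this
      exact_mod_cast this
    have : (-x)^r = (-1)^r * x^r := by rw [← mul_pow]; simp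
    rw [this, pow_add, pow_add]
    linear_combination -(-1:ℝ)^l * (-1)^r * x^l * x^r * ((b+k).descFactorial (k-l) : ℝ) * ((a+k).descFactorial l : ℝ) * hc
  rw [Finset.sum_congr rfl h1]
  rw [Finset.sum_comm' (t' := Finset.range (k+1)) (s' := fun n => Finset.range (n+1))]
  · refine Finset.sum_congr rfl fun n hn => ?_
    rw [← Finset.mul_sum, aux_vander a b k n (by have := Finset.mem_range.1 hn; omega)]
    ring
  · intro l n
    simp only [Finset.mem_range, Finset.mem_Ico]
    omega

lemma aux_jacobi (a b k : ℕ) (x : ℝ) (h0 : x ≠ 0) (h1 : x ≠ 1) :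
    jacobiP a b k (2*x-1) = (-1)^k / k.factorial * 
    ((b+k).factorial / (a+b+k).factorial) *
    ∑ n ∈ Finset.range (k+1), (-1:ℝ)^n * (k.choose n) * ((a+b+k+n).factorial / (b+n).factorial) * x^n := by
  have hex := aux_expand a b k x
  have hr : ∑ n ∈ Finset.range (k+1), (-1:ℝ)^n * (k.choose n) * 
      ((b+k).factorial * (a+b+k+n).factorial / ((b+n).factorial * (a+b+k).factorial)) * x^n =
    ((b+k).factorial / (a+b+k).factorial : ℝ) *
    ∑ n ∈ Finset.range (k+1), (-1:ℝ)^n * (k.choose n) * ((a+b+k+n).factorial / (b+n).factorial) * x^n := by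
    rw [Finset.mul_sum]
    refine Finset.sum_congr rfl fun n _ => ?_
    field_simp
  rw [hr] at hex
  rw [mul_assoc, ← hex, jacobiP, aux_deriv]
  have e1 : (1 - (2*x-1)) = 2 * (1-x) := by ring
  have e2 : (1 + (2*x-1)) = 2 * x := by ring
  have h1' : 1 - x ≠ 0 := sub_ne_zero.2 h1.symm
  rw [e1, e2, Finset.mul_sum, Finset.mul_sum]
  refine Finset.sum_congr rfl fun l hl => ?_
  have hl : l ≤ k := by have := Finset.mem_range.1 hl; omega
  obtain ⟨q, rfl⟩ := Nat.exists_eq_add_of_le hl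
  rw [show a + (l+q) - l = a + q by omega, Nat.add_sub_cancel_left]
  simp only [mul_pow, pow_add]
  field_simp

def auxS (d : ℕ) (T : ℝ) : Set (Fin d → ℝ) :=
  {x | (∀ i, x i ∈ Set.Icc (0:ℝ) T) ∧ ∀ i j : Fin d, i ≤ j → x i ≤ x j}

lemma auxS_closed (d : ℕ) (T : ℝ) : IsClosed (auxS d T) := by
  have : auxS d T = (⋂ i, {x : Fin d → ℝ | x i ∈ Set.Icc (0:ℝ) T}) ∩ ⋂ i, ⋂ j, ⋂ (_ : i ≤ j), {x : Fin d → ℝ | x i ≤ x j} := by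
    ext x; simp [auxS]
  rw [this]
  refine IsClosed.inter (isClosed_iInter fun i => isClosed_Icc.preimage (continuous_apply i)) ?_
  exact isClosed_iInter fun i => isClosed_iInter fun j => isClosed_iInter fun _ =>
    isClosed_le (continuous_apply i) (continuous_apply j)

lemma auxS_compact (d : ℕ) (T : ℝ) : IsCompact (auxS d T) := by
  refine IsCompact.of_isClosed_subset (isCompact_univ_pi (fun _ : Fin d => isCompact_Icc (a := (0:ℝ)) (b := T))) (auxS_closed d T) ?_
  intro x hx i _
  exact hx.1 i

lemma auxS_succ (d : ℕ) (T t : ℝ) (y : Fin d → ℝ) :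
    (Fin.insertNth (α := fun _ => ℝ) (Fin.last d) t y) ∈ auxS (d+1) T ↔ t ∈ Set.Icc 0 T ∧ y ∈ auxS d t := by
  rw [Fin.insertNth_last']
  simp only [auxS, Set.mem_ofPred_eq]
  constructor
  · rintro ⟨h1, h2⟩
    have ht := h1 (Fin.last d)
    rw [Fin.snoc_last] at ht
    refine ⟨ht, fun i => ⟨?_, ?_⟩, fun i j hij => ?_⟩
    · have := (h1 i.castSucc).1
      simpa using this
    · have := h2 i.castSucc (Fin.last d) (Fin.le_last _)
      simpa using this
    · have := h2 i.castSucc j.castSucc (by simpa using hij)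
      simpa using this
  · rintro ⟨ht, h1, h2⟩
    refine ⟨fun i => ?_, fun i j => ?_⟩
    · refine Fin.lastCases ?_ (fun i => ?_) i
      · simpa using ht
      · have := h1 i
        simp only [Fin.snoc_castSucc]
        exact ⟨this.1, this.2.trans ht.2⟩
    · refine Fin.lastCases ?_ (fun j => ?_) j
      · intro _
        refine Fin.lastCases ?_ (fun i => ?_) i
        · simp
        · simpa using (h1 i).2
      · refine Fin.lastCases ?_ (fun i => ?_) i
        · intro h
          exact absurd (Fin.castSucc_lt_last j) (not_lt.2 h)
        · intro h
          simpa using h2 i j (by simpa using h)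

lemma aux_moment (e : ℕ → ℕ) (d : ℕ) : ∀ (T : ℝ), 0 ≤ T →
    ∫ x in auxS d T, ∏ l : Fin d, x l ^ e l.1 =
      T^(d + ∑ l ∈ Finset.range d, e l) * ∏ l ∈ Finset.range d, (1 / ((l:ℝ) + 1 + (∑ m ∈ Finset.range (l+1), e m : ℕ))) := by
  induction d with
  | zero =>
    intro T hT
    have : auxS 0 T = Set.univ := by ext x; simp [auxS]
    rw [this]
    simp [measureReal_def, volume_pi]
  | succ d ih =>
    intro T hT
    have hmp := (volume_preserving_piFinSuccAbove (fun _ : Fin (d+1) => ℝ) (Fin.last d)).symm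
    rw [← hmp.setIntegral_preimage_emb (MeasurableEquiv.measurableEmbedding _)]
    have hint : IntegrableOn (fun x : Fin (d+1) → ℝ => ∏ l : Fin (d+1), x l ^ e l.1) (auxS (d+1) T) :=
      ContinuousOn.integrableOn_compact (auxS_compact _ _) (by fun_prop)
    have hint2 := (hmp.integrableOn_comp_preimage (MeasurableEquiv.measurableEmbedding _)).2 hint
    have hms : MeasurableSet ((MeasurableEquiv.piFinSuccAbove (fun _ : Fin (d+1) => ℝ) (Fin.last d)).symm ⁻¹' auxS (d+1) T) :=
      (MeasurableEquiv.measurable _) (auxS_closed _ _).measurableSet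
    rw [← integral_indicator hms]
    rw [← integrable_indicator_iff hms] at hint2
    rw [Measure.volume_eq_prod] at hint2 ⊢
    simp only [Function.comp_def] at hint2
    rw [integral_prod _ hint2]
    have hin : ∀ t : ℝ, ∫ y : Fin d → ℝ, ((MeasurableEquiv.piFinSuccAbove (fun _ : Fin (d+1) => ℝ) (Fin.last d)).symm ⁻¹' auxS (d+1) T).indicator
        (fun z => ∏ l : Fin (d+1), ((MeasurableEquiv.piFinSuccAbove (fun _ : Fin (d+1) => ℝ) (Fin.last d)).symm z) l ^ e l.1) (t, y) =
        (Set.Icc 0 T).indicator (fun t => t^(d + ∑ l ∈ Finset.range (d+1), e l) * ∏ l ∈ Finset.range d, (1 / ((l:ℝ) + 1 + (∑ m ∈ Finset.range (l+1), e m : ℕ)))) t := by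
      intro t
      by_cases ht : t ∈ Set.Icc 0 T
      · rw [Set.indicator_of_mem ht]
        have : ∀ y : Fin d → ℝ, ((MeasurableEquiv.piFinSuccAbove (fun _ : Fin (d+1) => ℝ) (Fin.last d)).symm ⁻¹' auxS (d+1) T).indicator
          (fun z => ∏ l : Fin (d+1), ((MeasurableEquiv.piFinSuccAbove (fun _ : Fin (d+1) => ℝ) (Fin.last d)).symm z) l ^ e l.1) (t, y)
           = (auxS d t).indicator (fun y => t ^ e d * ∏ l : Fin d, y l ^ e l.1) y := by
          intro y
          have hiff : (t, y) ∈ ((MeasurableEquiv.piFinSuccAbove (fun _ : Fin (d+1) => ℝ) (Fin.last d)).symm ⁻¹' auxS (d+1) T) ↔ y ∈ auxS d t := by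
            rw [Set.mem_preimage]
            exact (auxS_succ d T t y).trans (and_iff_right ht)
          by_cases hy : y ∈ auxS d t
          · rw [Set.indicator_of_mem (hiff.2 hy), Set.indicator_of_mem hy, Fin.prod_univ_castSucc]
            have hz : (MeasurableEquiv.piFinSuccAbove (fun _ : Fin (d+1) => ℝ) (Fin.last d)).symm (t, y) = Fin.snoc (α := fun _ => ℝ) y t := by
              rw [← Fin.insertNth_last']; rfl
            simp only [hz, Fin.snoc_castSucc, Fin.snoc_last, Fin.val_castSucc, Fin.val_last]
            ring
          · rw [Set.indicator_of_notMem (fun h => hy (hiff.1 h)), Set.indicator_of_notMem hy]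
        simp only [this]
        rw [integral_indicator (auxS_closed _ _).measurableSet, integral_const_mul, ih t ht.1, Finset.sum_range_succ]
        ring
      · rw [Set.indicator_of_notMem ht]
        have : ∀ y : Fin d → ℝ, ((MeasurableEquiv.piFinSuccAbove (fun _ : Fin (d+1) => ℝ) (Fin.last d)).symm ⁻¹' auxS (d+1) T).indicator
          (fun z => ∏ l : Fin (d+1), ((MeasurableEquiv.piFinSuccAbove (fun _ : Fin (d+1) => ℝ) (Fin.last d)).symm z) l ^ e l.1) (t, y) = 0 := by
          intro y
          apply Set.indicator_of_notMem
          intro h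
          exact ht ((auxS_succ d T t y).1 h).1
        simp only [this, integral_zero]
    rw [integral_congr_ae (Filter.Eventually.of_forall hin), integral_indicator measurableSet_Icc,
      integral_Icc_eq_integral_Ioc, ← intervalIntegral.integral_of_le hT, intervalIntegral.integral_mul_const,
      integral_pow, Finset.prod_range_succ]
    have e1 : d + 1 + ∑ l ∈ Finset.range (d+1), e l = d + ∑ l ∈ Finset.range (d+1), e l + 1 := by ring
    rw [e1]
    push_cast
    simp only [ne_eq, Nat.add_eq_zero_iff, one_ne_zero, and_false, not_false_eq_true, zero_pow, sub_zero]
    ring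

lemma aux_prod (n m i j : ℕ) (hij : i ≤ j) (d : ℕ) (hjd : j + 1 ≤ d) :
    ∏ l ∈ Finset.range d, (1 / ((l:ℝ) + 1 + (∑ r ∈ Finset.range (l+1), ((if r = i then n else 0) + (if r = j then m else 0)) : ℕ))) =
    ((n+i).factorial : ℝ) / (i.factorial * (n+j).factorial) * ((n+m+j).factorial / (n+m+d).factorial) := by
  have hE : ∀ l, ∑ r ∈ Finset.range (l+1), ((if r = i then n else 0) + (if r = j then m else 0)) = (if i ≤ l then n else 0) + (if j ≤ l then m else 0) := by
    intro l
    rw [Finset.sum_add_distrib, Finset.sum_ite_eq', Finset.sum_ite_eq']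
    simp only [Finset.mem_range, Nat.lt_succ_iff]
  simp only [hE]
  have h1 : ∀ D, D ≤ i → ∏ l ∈ Finset.range D, (1 / ((l:ℝ) + 1 + ((if i ≤ l then n else 0) + (if j ≤ l then m else 0) : ℕ))) = 1 / (D.factorial : ℝ) := by
    intro D
    induction D with
    | zero => simp
    | succ D ih =>
      intro hD
      rw [Finset.prod_range_succ, ih (by omega), if_neg (by omega), if_neg (by omega), Nat.factorial_succ]
      push_cast; field_simp; try simp
  have h2 : ∀ D, i ≤ D → D ≤ j → ∏ l ∈ Finset.range D, (1 / ((l:ℝ) + 1 + ((if i ≤ l then n else 0) + (if j ≤ l then m else 0) : ℕ))) = ((n+i).factorial : ℝ) / (i.factorial * (n+D).factorial) := by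
    intro D hD
    induction D, hD using Nat.le_induction with
    | base => intro _; rw [h1 i le_rfl]; have := Nat.factorial_pos (n+i); field_simp
    | succ D hD ih =>
      intro hDj
      rw [Finset.prod_range_succ, ih (by omega), if_pos (by omega), if_neg (by omega), ← add_assoc, Nat.factorial_succ]
      push_cast; field_simp; ring
  induction d, hjd using Nat.le_induction with
  | base =>
    rw [Finset.prod_range_succ, h2 j hij le_rfl, if_pos hij, if_pos le_rfl, ← add_assoc, Nat.factorial_succ]
    have := Nat.factorial_pos (n+m+j)
    push_cast; field_simp; ring
  | succ D hD ih =>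
    rw [Finset.prod_range_succ, ih, if_pos (by omega), if_pos (by omega), ← add_assoc, Nat.factorial_succ]
    push_cast; field_simp; ring

lemma aux_mom2 (d n m : ℕ) (i j : Fin d) (hij : i ≤ j) :
    ∫ x in simplexD d, x i ^ n * x j ^ m =
    ((n+i).factorial : ℝ) / (i.1.factorial * (n+j).factorial) * ((n+m+j).factorial / (n+m+d).factorial) := by
  have h := aux_moment (fun r => (if r = i.1 then n else 0) + (if r = j.1 then m else 0)) d 1 zero_le_one
  rw [aux_prod n m i j hij d j.2, one_pow, one_mul] at h
  rw [← h]
  refine integral_congr_ae (Filter.Eventually.of_forall fun x => ?_)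
  simp only [pow_add, Finset.prod_mul_distrib]
  have (q : ℕ) (i : Fin d) : ∏ l : Fin d, x l ^ (if l.1 = i.1 then q else 0) = x i ^ q := by
    rw [Finset.prod_eq_single i]
    · simp
    · intro b _ hb
      rw [if_neg (fun h => hb (Fin.ext h)), pow_zero]
    · simp
  rw [this, this]

lemma aux_poly_int (d K : ℕ) (i j : Fin d) (hij : i ≤ j) (a b : ℕ → ℝ) :
    ∫ x in simplexD d, (∑ n ∈ Finset.range K, a n * x i ^ n) * (∑ m ∈ Finset.range K, b m * x j ^ m) =
    ∑ n ∈ Finset.range K, ∑ m ∈ Finset.range K, a n * b m *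
    (((n+i).factorial : ℝ) / (i.1.factorial * (n+j).factorial) * ((n+m+j).factorial / (n+m+d).factorial)) := by
  have hint : ∀ n m, IntegrableOn (fun x : Fin d → ℝ => a n * b m * (x i ^ n * x j ^ m)) (simplexD d) := fun n m =>
      ContinuousOn.integrableOn_compact (auxS_compact d 1) (by fun_prop)
  have : ∀ x : Fin d → ℝ, (∑ n ∈ Finset.range K, a n * x i ^ n) * (∑ m ∈ Finset.range K, b m * x j ^ m) =
     ∑ n ∈ Finset.range K, ∑ m ∈ Finset.range K, a n * b m * (x i ^ n * x j ^ m) := by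
    intro x
    rw [Finset.sum_mul_sum]
    refine Finset.sum_congr rfl fun n _ => Finset.sum_congr rfl fun m _ => by ring
  simp only [this]
  rw [integral_finsetSum _ (fun n _ => integrable_finsetSum _ fun m _ => hint n m)]
  refine Finset.sum_congr rfl fun n _ => ?_
  rw [integral_finsetSum _ (fun m _ => hint n m)]
  refine Finset.sum_congr rfl fun m _ => ?_
  rw [integral_const_mul, aux_mom2 d n m i j hij]

noncomputable def auxU (D k i : ℕ) : ℝ :=
  Real.sqrt (((D - i).factorial * (k + i).factorial : ℝ) / (i.factorial * (k + (D - i)).factorial))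

lemma auxU_pos (D k i : ℕ) : 0 < auxU D k i := by
  unfold auxU; positivity

lemma auxU_sq (D k i : ℕ) : auxU D k i ^ 2 =
    (((D - i).factorial * (k + i).factorial : ℝ) / (i.factorial * (k + (D - i)).factorial)) := by
  unfold auxU; rw [Real.sq_sqrt (by positivity)]

lemma aux_phi (D k i : ℕ) (hi : i ≤ D) (t : ℝ) (h0 : t ≠ 0) (h1 : t ≠ 1) :
    phiB (D+1) (i+1) k t =
      (Real.sqrt ((2*k+(D+1)) * k.factorial * (k+D).factorial) * ((-1)^k / (k.factorial * (k+D).factorial))) *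
        (i.factorial * auxU D k i) *
      ∑ n ∈ Finset.range (k+1), ((-1:ℝ)^n * (k.choose n) * ((D+k+n).factorial / (i+n).factorial)) * t^n := by
  obtain ⟨e, rfl⟩ := Nat.exists_eq_add_of_le hi
  unfold phiB auxU
  have e1 : i + e + 1 - (i + 1) = e := by omega
  have e2 : k + (i + e + 1) - (i+1) = k + e := by omega
  rw [e1, e2, show i + 1 - 1 = i by omega, show k + (i + e + 1) - 1 = k + (i+e) by omega,
    show k + (i+1) - 1 = k + i by omega, Nat.add_sub_cancel_left, aux_jacobi _ _ _ _ h0 h1,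
    show e + i + k = k + (i+e) by ring, show i + e + k = k + (i+e) by ring, show i + k = k + i by ring]
  have hs : Real.sqrt ((((2*k+(i+e+1)) * k.factorial * (k+(i+e)).factorial : ℕ) : ℝ) /
      (((k+e).factorial * (k+i).factorial : ℕ) : ℝ)) * Real.sqrt ((e.factorial * i.factorial : ℕ) : ℝ) *
      (k+i).factorial =
      Real.sqrt ((2*k+((i+e:ℕ)+1)) * k.factorial * (k+(i+e)).factorial) *
      (i.factorial * Real.sqrt ((e.factorial * (k + i).factorial : ℝ) / (i.factorial * (k + e).factorial))) := by
    have ha : ((k+i).factorial : ℝ) = Real.sqrt (((k+i).factorial : ℝ)^2) := (Real.sqrt_sq (by positivity)).symm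
    have hb : (i.factorial : ℝ) * Real.sqrt ((e.factorial * (k + i).factorial : ℝ) / (i.factorial * (k + e).factorial)) =
       Real.sqrt ((i.factorial : ℝ)^2 * ((e.factorial * (k + i).factorial : ℝ) / (i.factorial * (k + e).factorial))) := by
      rw [Real.sqrt_mul (by positivity), Real.sqrt_sq (by positivity)]
    rw [hb]
    nth_rewrite 1 [ha]
    rw [← Real.sqrt_mul (by positivity), ← Real.sqrt_mul (by positivity), ← Real.sqrt_mul (by positivity)]
    congr 1
    push_cast
    field_simp
  generalize (∑ n ∈ Finset.range (k+1), ((-1:ℝ)^n * (k.choose n) * ((k+(i+e)+n).factorial / (i+n).factorial)) * t^n) = W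
  have hk := Nat.factorial_pos k
  have hk2 := Nat.factorial_pos (k+(i+e))
  push_cast at hs ⊢
  linear_combination ((-1)^k / (k.factorial * (k+(i+e)).factorial) * W) * hs

lemma aux_entry (D k : ℕ) (i j : Fin (D+1)) (hij : i ≤ j) :
    ∫ x in simplexD (D+1), phiB (D+1) (i.1+1) k (x i) * phiB (D+1) (j.1+1) k (x j) =
    auxU D k i / auxU D k j := by
  have hj : j.1 ≤ D := by omega
  have hi : i.1 ≤ D := by omega
  let c := (Real.sqrt ((2*k+(D+1)) * k.factorial * (k+D).factorial) * ((-1)^k / (k.factorial * (k+D).factorial)))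
  let A : ℕ → ℕ → ℝ := fun i n => ((-1:ℝ)^n * (k.choose n) * ((D+k+n).factorial / (i+n).factorial))
  have hae : ∀ᵐ x : Fin (D+1) → ℝ ∂(volume.restrict (simplexD (D+1))),
      phiB (D+1) (i.1+1) k (x i) * phiB (D+1) (j.1+1) k (x j) =
      (c * (i.1.factorial * auxU D k i)) * (c * (j.1.factorial * auxU D k j)) *
       ((∑ n ∈ Finset.range (k+1), A i n * x i ^ n) * (∑ n ∈ Finset.range (k+1), A j n * x j ^ n)) := by
    apply ae_restrict_of_ae
    have hne : ∀ (i : Fin (D+1)) (a : ℝ), ∀ᵐ x : Fin (D+1) → ℝ, x i ≠ a := fun i a =>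
      Measure.ae_eval_ne (μ := fun _ : Fin (D+1) => (volume : Measure ℝ)) i a
    filter_upwards [hne i 0, hne i 1, hne j 0, hne j 1] with x h1 h2 h3 h4
    rw [aux_phi D k i hi _ h1 h2, aux_phi D k j hj _ h3 h4]
    ring
  rw [integral_congr_ae hae, integral_const_mul, aux_poly_int (D+1) (k+1) i j hij]
  have hd := aux_double D k i j hj
  rw [show (∑ n ∈ Finset.range (k+1), ∑ m ∈ Finset.range (k+1), A i n * A j m *
    (((n+i).factorial : ℝ) / (i.1.factorial * (n+j).factorial) * ((n+m+j).factorial / (n+m+(D+1)).factorial))) = _ from hd]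
  have hc : c * c = (2*k+D+1) / (k.factorial * (k+D).factorial) := by
    have h1 : (-1:ℝ)^k * (-1)^k = 1 := by rw [← mul_pow]; simp
    have h2 := Real.mul_self_sqrt (show (0:ℝ) ≤ ((2*k+(D+1)) * k.factorial * (k+D).factorial) by positivity)
    calc c * c = (Real.sqrt ((2*k+(D+1)) * k.factorial * (k+D).factorial) * Real.sqrt ((2*k+(D+1)) * k.factorial * (k+D).factorial))
          * (((-1)^k * (-1)^k) / ((k.factorial * (k+D).factorial) * (k.factorial * (k+D).factorial))) := by
            simp only [c]; ring
      _ = _ := by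
        rw [h1, h2]
        field_simp
        ring
  have hu := auxU_sq D k j
  have hup := auxU_pos D k j
  have : auxU D k i / auxU D k j = auxU D k i * auxU D k j / auxU D k j ^ 2 := by field_simp
  rw [this, hu]
  rw [show ∀ a b e : ℝ, c * a * (c * b) * e = (c * c) * (a * b * e) from fun a b e => by ring,
    hc, add_comm j.1 k]
  field_simp

/-- The smallest eigenvalue of the Gram matrix `R_k` equals `k/(k+d-1) ≥ 1/d`. -/
theorem statement8 (d k : ℕ) (hd : 2 ≤ d) (hk : 1 ≤ k)
    (R : Matrix (Fin d) (Fin d) ℝ)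
    (hR : ∀ i j : Fin d,
      R i j = ∫ x in simplexD d, phiB d (i.1+1) k (x i) * phiB d (j.1+1) k (x j)) :
    Module.End.HasEigenvalue (Matrix.toLin' R) ((k:ℝ)/(k+d-1)) ∧
    (∀ μ : ℝ, Module.End.HasEigenvalue (Matrix.toLin' R) μ → (k:ℝ)/(k+d-1) ≤ μ) ∧
    (1:ℝ)/d ≤ (k:ℝ)/(k+d-1) := by
  obtain ⟨D, rfl⟩ : ∃ D, d = D + 1 := ⟨d - 1, by omega⟩
  refine aux_linalg (D+1) k hd hk (auxU D k) (auxU_pos D k) ?_ R ?_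
  · intro m hm
    rw [auxU_sq, auxU_sq]
    obtain ⟨e, rfl⟩ := Nat.exists_eq_add_of_le (show m + 1 ≤ D by omega)
    rw [Nat.add_sub_cancel_left, show m + 1 + e - m = e + 1 by omega, ← add_assoc, ← add_assoc,
      Nat.factorial_succ e, Nat.factorial_succ m, Nat.factorial_succ (k+m), Nat.factorial_succ (k+e)]
    push_cast
    field_simp
    ring
  · intro i j
    rw [hR]
    rcases le_total i j with h | h
    · rw [aux_entry D k i j h, min_eq_left (show i.1 ≤ j.1 from h), max_eq_right (show i.1 ≤ j.1 from h)]
    · rw [min_eq_right (show j.1 ≤ i.1 from h), max_eq_left (show j.1 ≤ i.1 from h), ← aux_entry D k j i h]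
      refine integral_congr_ae (Filter.Eventually.of_forall fun x => ?_)
      exact mul_comm _ _
end

section
/- For every θ = (θ_{i,k}; 1 ≤ i ≤ d, 1 ≤ k ≤ m_i) ∈ ℝ^{|m|}, the function θ·φ_m = Σ_{i=1}^d Σ_{k=1}^{m_i} θ_{i,k} φ_{i,k}(x_i) on △ satisfies ‖θ‖/√d ≤ ‖θ·φ_m‖_{L^2(△)} ≤ √d ‖θ‖, where ‖θ‖ is the Euclidean norm. -/
open MeasureTheory Real

noncomputable def lincomb (d : ℕ) (m : Fin d → ℕ) (θ : (i : Fin d) → Fin (m i) → ℝ)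
    (x : Fin d → ℝ) : ℝ :=
  ∑ i, ∑ k, θ i k * phiB d (i.1+1) (k.1+1) (x i)

noncomputable def psiFun (d : ℕ) (m : Fin d → ℕ) (θ : (i : Fin d) → Fin (m i) → ℝ) : ℝ :=
  Real.log (∫ x in simplexD d, Real.exp (lincomb d m θ x))

noncomputable def fdens (d : ℕ) (m : Fin d → ℕ) (θ : (i : Fin d) → Fin (m i) → ℝ)
    (x : Fin d → ℝ) : ℝ :=
  Real.exp (lincomb d m θ x - psiFun d m θ)

noncomputable def Amap (d : ℕ) (m : Fin d → ℕ) (θ : (i : Fin d) → Fin (m i) → ℝ) :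
    (i : Fin d) → Fin (m i) → ℝ :=
  fun i k => ∫ x in simplexD d, phiB d (i.1+1) (k.1+1) (x i) * fdens d m θ x

noncomputable def eunorm (d : ℕ) (m : Fin d → ℕ) (θ : (i : Fin d) → Fin (m i) → ℝ) : ℝ :=
  Real.sqrt (∑ i, ∑ k, (θ i k)^2)


def sY (n : ℕ) (y : ℝ) : Set (Fin n → ℝ) :=
  {x | (∀ i, x i ∈ Set.Icc (0:ℝ) y) ∧ ∀ i j : Fin n, i ≤ j → x i ≤ x j}

lemma sY_meas (n : ℕ) (y : ℝ) : MeasurableSet (sY n y) := by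
  apply IsClosed.measurableSet
  have : sY n y = (⋂ i, {x | x i ∈ Set.Icc (0:ℝ) y}) ∩ ⋂ i, ⋂ j, ⋂ (_ : i ≤ j), {x | x i ≤ x j} := by
    ext x; simp [sY]
  rw [this]
  refine IsClosed.inter (isClosed_iInter fun i => ?_)
    (isClosed_iInter fun i => isClosed_iInter fun j => isClosed_iInter fun _ => ?_)
  · exact isClosed_Icc.preimage (continuous_apply i)
  · exact isClosed_le (continuous_apply i) (continuous_apply j)

lemma sY_snoc (n : ℕ) (y t : ℝ) (x : Fin n → ℝ) :
    (Fin.snoc x t : Fin (n+1) → ℝ) ∈ sY (n+1) y ↔ t ∈ Set.Icc 0 y ∧ x ∈ sY n t := by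
  simp only [sY, Set.mem_ofPred_eq, Fin.forall_fin_succ', Fin.snoc_castSucc, Fin.snoc_last,
    Set.mem_Icc, Fin.castSucc_le_castSucc_iff, Fin.le_last, le_refl, forall_true_left]
  constructor
  · rintro ⟨⟨h1, h2⟩, h3, h4⟩
    exact ⟨h2, fun i => ⟨(h1 i).1, (h3 i).2⟩, fun i j => (h3 i).1 j⟩
  · rintro ⟨h2, h1, h3⟩
    refine ⟨⟨fun i => ⟨(h1 i).1, (h1 i).2.trans h2.2⟩, h2⟩, fun i => ⟨h3 i, (h1 i).2⟩, ?_⟩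
    refine ⟨fun i h => absurd h (by simp [Fin.le_def] ), trivial⟩

lemma lint_simplex (e : ℕ → ℕ) : ∀ (n : ℕ) (y : ℝ), 0 ≤ y →
    ∫⁻ x in sY n y, ENNReal.ofReal (∏ i : Fin n, x i ^ e i) =
      ENNReal.ofReal (y^(n+∑ l ∈ Finset.range n, e l) *
        ∏ l ∈ Finset.range n, (1/((l:ℝ)+1+∑ l' ∈ Finset.range (l+1), (e l' : ℝ)))) := by
  intro n
  induction n with
  | zero =>
    intro y hy
    have : sY 0 y = Set.univ := by ext x; simp [sY]
    simp only [this]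
    rw [volume_pi, Measure.pi_of_empty]
    simp
  | succ n ih =>
    intro y hy
    rw [← lintegral_indicator (sY_meas _ _)]
    rw [← ((volume_preserving_piFinSuccAbove (fun _ : Fin (n+1) => ℝ) (Fin.last n)).symm).lintegral_comp_emb (MeasurableEquiv.measurableEmbedding _)]
    rw [Measure.volume_eq_prod, lintegral_prod]
    · have key : ∀ t : ℝ, ∫⁻ x : Fin n → ℝ, (sY (n+1) y).indicator (fun x => ENNReal.ofReal (∏ i : Fin (n+1), x i ^ e i))
          ((MeasurableEquiv.piFinSuccAbove (fun _ : Fin (n+1) => ℝ) (Fin.last n)).symm (t, x)) =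
          (Set.Icc 0 y).indicator (fun t => ENNReal.ofReal (t^(n+∑ l ∈ Finset.range (n+1), e l) * ∏ l ∈ Finset.range n, (1/((l:ℝ)+1+∑ l' ∈ Finset.range (l+1), (e l' : ℝ))))) t := by
        intro t
        have h0 : ∀ x : Fin n → ℝ, (MeasurableEquiv.piFinSuccAbove (fun _ : Fin (n+1) => ℝ) (Fin.last n)).symm (t, x) = (Fin.snoc x t : Fin (n+1) → ℝ) := by
          intro x
          simp [MeasurableEquiv.piFinSuccAbove]
          rfl
        simp_rw [h0]
        by_cases ht : t ∈ Set.Icc 0 y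
        · rw [Set.indicator_of_mem ht]
          have h1 : ∀ x : Fin n → ℝ, (sY (n+1) y).indicator (fun x => ENNReal.ofReal (∏ i : Fin (n+1), x i ^ e i)) (Fin.snoc x t : Fin (n+1) → ℝ) = ENNReal.ofReal (t ^ e n) * (sY n t).indicator (fun x => ENNReal.ofReal (∏ i : Fin n, x i ^ e i)) x := by
            intro x
            by_cases hx : x ∈ sY n t
            · rw [Set.indicator_of_mem hx, Set.indicator_of_mem ((sY_snoc n y t x).2 ⟨ht, hx⟩)]
              rw [Fin.prod_univ_castSucc, ← ENNReal.ofReal_mul (pow_nonneg ht.1 _)]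
              simp [mul_comm]
            · rw [Set.indicator_of_notMem hx, Set.indicator_of_notMem (fun h => hx ((sY_snoc n y t x).1 h).2)]
              simp
          simp_rw [h1]
          rw [lintegral_const_mul' _ _ ENNReal.ofReal_ne_top, lintegral_indicator (sY_meas _ _), ih t ht.1,
            ← ENNReal.ofReal_mul (pow_nonneg ht.1 _), Finset.sum_range_succ]
          congr 1
          ring
        · rw [Set.indicator_of_notMem ht]
          have : ∀ x : Fin n → ℝ, (sY (n+1) y).indicator (fun x => ENNReal.ofReal (∏ i : Fin (n+1), x i ^ e i)) (Fin.snoc x t : Fin (n+1) → ℝ) = 0 := fun x =>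
            Set.indicator_of_notMem (fun h => ht ((sY_snoc n y t x).1 h).1) _
          simp [this]
      simp_rw [key]
      rw [lintegral_indicator measurableSet_Icc, ← ofReal_integral_eq_lintegral_ofReal]
      · congr 1
        rw [integral_mul_const, integral_Icc_eq_integral_Ioc, ← intervalIntegral.integral_of_le hy, integral_pow,
          Finset.prod_range_succ]
        push_cast
        have : (n:ℝ) + 1 + ∑ l' ∈ Finset.range (n+1), (e l' : ℝ) ≠ 0 := by positivity
        rw [show (n:ℝ) + ∑ l' ∈ Finset.range (n+1), (e l' : ℝ) + 1 = (n:ℝ) + 1 + ∑ l' ∈ Finset.range (n+1), (e l' : ℝ) by ring]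
        rw [show n + 1 + ∑ l ∈ Finset.range (n + 1), e l = n + ∑ l ∈ Finset.range (n + 1), e l + 1 by ring]
        simp
        ring
      · exact (by fun_prop : Continuous _).continuousOn.integrableOn_Icc
      · filter_upwards [ae_restrict_mem measurableSet_Icc] with t ht
        have := ht.1
        positivity
    · apply Measurable.aemeasurable
      refine Measurable.comp (g := (sY (n+1) y).indicator (fun x => ENNReal.ofReal (∏ i : Fin (n+1), x i ^ e i))) ?_ (MeasurableEquiv.measurable _)
      refine Measurable.indicator ?_ (sY_meas _ _)
      fun_prop

lemma int_simplex (e : ℕ → ℕ) (d : ℕ) :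
    ∫ x in sY d 1, (∏ i : Fin d, x i ^ e i) =
        ∏ l ∈ Finset.range d, (1/((l:ℝ)+1+∑ l' ∈ Finset.range (l+1), (e l' : ℝ))) := by
  rw [integral_eq_lintegral_of_nonneg_ae, lint_simplex e d 1 zero_le_one, ENNReal.toReal_ofReal]
  · simp
  · positivity
  · filter_upwards [ae_restrict_mem (sY_meas d 1)] with x hx
    exact Finset.prod_nonneg fun i _ => pow_nonneg (hx.1 i).1 _
  · exact (by fun_prop : Continuous _).aestronglyMeasurable

lemma prod_formula (i j a b : ℕ) (hij : i ≤ j) (e : ℕ → ℕ)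
    (he : e = fun n => (if n = i then a else 0) + (if n = j then b else 0)) (d : ℕ) (hd : j < d) :
    ∏ l ∈ Finset.range d, (1/((l:ℝ)+1+∑ l' ∈ Finset.range (l+1), (e l' : ℝ)))
     = ((a+i).factorial : ℝ) * (a+b+j).factorial / (i.factorial * (a+j).factorial * (a+b+d).factorial) := by
  have hs : ∀ l, ∑ l' ∈ Finset.range (l+1), (e l' : ℝ) = (if i ≤ l then (a:ℝ) else 0) + (if j ≤ l then (b:ℝ) else 0) := by
    intro l
    subst he
    push_cast
    rw [Finset.sum_add_distrib]
    simp [Nat.lt_succ_iff]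
  simp_rw [hs]
  have h1 : ∀ n, n ≤ i → ∏ l ∈ Finset.range n, (1/((l:ℝ)+1+((if i ≤ l then (a:ℝ) else 0) + (if j ≤ l then (b:ℝ) else 0)))) = 1 / n.factorial := by
    intro n
    induction n with
    | zero => simp
    | succ n ih =>
      intro hn
      rw [Finset.prod_range_succ, ih (by omega), if_neg (by omega), if_neg (by omega), Nat.factorial_succ]
      push_cast
      field_simp
      simp
  have h2 : ∀ n, i ≤ n → n ≤ j → ∏ l ∈ Finset.range n, (1/((l:ℝ)+1+((if i ≤ l then (a:ℝ) else 0) + (if j ≤ l then (b:ℝ) else 0)))) = (a+i).factorial / (i.factorial * (a+n).factorial) := by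
    intro n hn
    induction n, hn using Nat.le_induction with
    | base => intro _; rw [h1 i le_rfl]; field_simp
    | succ n hn ih =>
      intro hn'
      rw [Finset.prod_range_succ, ih (by omega), if_pos hn, if_neg (by omega), ← add_assoc a n 1, Nat.factorial_succ]
      push_cast
      field_simp
      ring
  have h3 : ∀ n, j ≤ n → ∏ l ∈ Finset.range n, (1/((l:ℝ)+1+((if i ≤ l then (a:ℝ) else 0) + (if j ≤ l then (b:ℝ) else 0)))) = ((a+i).factorial : ℝ) * (a+b+j).factorial / (i.factorial * (a+j).factorial * (a+b+n).factorial) := by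
    intro n hn
    induction n, hn using Nat.le_induction with
    | base => rw [h2 j hij le_rfl]; field_simp
    | succ n hn ih =>
      rw [Finset.prod_range_succ, ih, if_pos (by omega), if_pos (by omega), ← add_assoc (a+b) n 1, Nat.factorial_succ]
      push_cast
      field_simp
      ring
  exact h3 d hd.le

lemma moment (d : ℕ) (i j : Fin d) (hij : i ≤ j) (a b : ℕ) :
    ∫ x in sY d 1, x i ^ a * x j ^ b =
      ((a+i.1).factorial : ℝ) * (a+b+j.1).factorial / (i.1.factorial * (a+j.1).factorial * (a+b+d).factorial) := by
  rw [← prod_formula i.1 j.1 a b hij _ rfl d j.2, ← int_simplex]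
  congr 1
  ext x
  simp_rw [pow_add]
  rw [Finset.prod_mul_distrib]
  congr 1
  · rw [Finset.prod_eq_single i] <;> simp +contextual [Fin.ext_iff]
  · rw [Finset.prod_eq_single j] <;> simp +contextual [Fin.ext_iff]

/-- coefficient -/
noncomputable def cf (d i k t : ℕ) : ℝ := (-1)^t * (k.choose t) * (k+d-1+t).factorial / (t+i).factorial

lemma itd1 (n u : ℕ) (hu : u ≤ n) (s : ℝ) : iteratedDeriv u (fun s : ℝ => (1-s)^n) s =
   (-1)^u * (n.factorial / (n-u).factorial) * (1-s)^(n-u) := by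
  have := congrFun (iteratedDeriv_comp_const_sub u (fun x : ℝ => x^n) 1) s
  rw [this]
  simp only [iteratedDeriv_pow, smul_eq_mul]
  rw [Nat.descFactorial_eq_div hu, Nat.cast_div (Nat.factorial_dvd_factorial (by omega)) (by positivity)]
  ring

lemma itd2 (n u : ℕ) (hu : u ≤ n) (s : ℝ) : iteratedDeriv u (fun s : ℝ => (1+s)^n) s =
   (n.factorial / (n-u).factorial) * (1+s)^(n-u) := by
  have := congrFun (iteratedDeriv_comp_const_add u (fun x : ℝ => x^n) 1) s
  rw [this]
  simp only [iteratedDeriv_pow]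
  rw [Nat.descFactorial_eq_div hu, Nat.cast_div (Nat.factorial_dvd_factorial (by omega)) (by positivity)]

lemma itd (a b k : ℕ) (s : ℝ) : iteratedDeriv k (fun s : ℝ => (1-s)^a * (1+s)^b * (1-s^2)^k) s =
   (1-s)^a * (1+s)^b * ∑ u ∈ Finset.range (k+1), (k.choose u : ℝ) * (-1)^u *
     ((a+k).factorial / (a+k-u).factorial) * ((b+k).factorial / (b+u).factorial) * (1-s)^(k-u) * (1+s)^u := by
  have h : (fun s : ℝ => (1-s)^a * (1+s)^b * (1-s^2)^k) = fun s => (1-s)^(a+k) * (1+s)^(b+k) := by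
    ext s
    rw [show (1 - s^2) = (1-s)*(1+s) by ring, mul_pow]; ring
  rw [h, iteratedDeriv_fun_mul (by fun_prop) (by fun_prop), Finset.mul_sum]
  refine Finset.sum_congr rfl fun u hu => ?_
  have hu' : u ≤ k := by simpa [Nat.lt_succ_iff] using hu
  rw [itd1 _ _ (by omega), itd2 _ _ (by omega), show b + k - (k-u) = b+u by omega,
    show a + k - u = a + (k-u) by omega]
  ring

lemma vander (a b k t : ℕ) (ht : t ≤ k) : ∑ u ∈ Finset.range (t+1), (t.choose u : ℝ) *
    ((a+k).factorial / (a+k-u).factorial) * (1 / (b+u).factorial) = 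
    (a+b+k+t).factorial / ((b+t).factorial * (a+b+k).factorial) := by
  have h := Nat.add_choose_eq (a+k) (b+t) t
  rw [Finset.Nat.sum_antidiagonal_eq_sum_range_succ_mk] at h
  have h' : (((a+k+(b+t)).choose t : ℕ) : ℝ) = ∑ u ∈ Finset.range (t+1), ((a+k).choose u : ℝ) * (b+t).choose (t-u) := by
    rw [h]; push_cast; rfl
  have e : ((a+b+k+t).factorial : ℝ) / ((b+t).factorial * (a+b+k).factorial) = t.factorial / (b+t).factorial * (((a+k+(b+t)).choose t : ℕ) : ℝ) := by
    rw [Nat.cast_choose ℝ (by omega), show a+k+(b+t)-t = a+b+k by omega, show a+k+(b+t) = a+b+k+t by ring]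
    field_simp
  rw [e, h', Finset.mul_sum]
  refine Finset.sum_congr rfl fun u hu => ?_
  have hu' : u ≤ t := by simpa [Nat.lt_succ_iff] using hu
  rw [Nat.cast_choose ℝ hu', Nat.cast_choose ℝ (by omega : u ≤ a + k), Nat.cast_choose ℝ (by omega : t - u ≤ b+t),
    show b + t - (t-u) = b+u by omega]
  field_simp

lemma expand (a b k : ℕ) (x : ℝ) : ∑ u ∈ Finset.range (k+1), (k.choose u : ℝ) * (-1)^u *
     ((a+k).factorial / (a+k-u).factorial) * ((b+k).factorial / (b+u).factorial) * (1-x)^(k-u) * x^u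
    = (b+k).factorial / (a+b+k).factorial * ∑ t ∈ Finset.range (k+1), cf (a+b+1) b k t * x^t := by
  have h1 : ∀ u ∈ Finset.range (k+1), (k.choose u : ℝ) * (-1)^u *
     ((a+k).factorial / (a+k-u).factorial) * ((b+k).factorial / (b+u).factorial) * (1-x)^(k-u) * x^u =
     ∑ t ∈ Finset.range (k+1), if u ≤ t then (b+k).factorial * k.choose t * (-1)^t * x^t * ((t.choose u : ℝ) *
    ((a+k).factorial / (a+k-u).factorial) * (1 / (b+u).factorial)) else 0 := by
    intro u hu
    have hu' : u ≤ k := by simpa [Nat.lt_succ_iff] using hu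
    rw [show (1 - x) = (-x + 1) by ring, add_pow, Finset.mul_sum, Finset.sum_mul]
    rw [← Finset.sum_filter]
    refine Finset.sum_bij (fun v _ => v + u) ?_ ?_ ?_ ?_
    · intro v hv; simp at hv ⊢; omega
    · intro v _ w _ h; simpa using h
    · intro t ht
      simp at ht
      exact ⟨t - u, by simp; omega, by omega⟩
    · intro v hv
      have hv' : v ≤ k - u := by simpa [Nat.lt_succ_iff] using hv
      have := Nat.choose_mul (n := k) (k := v+u) (s := u) (by omega) 
      rw [show v + u - u = v by omega] at this
      have h2 : (k.choose (v+u) : ℝ) * (v+u).choose u = k.choose u * (k-u).choose v := by exact_mod_cast this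
      rw [one_pow, neg_pow, pow_add, pow_add]
      linear_combination (-(((b+k).factorial : ℝ)) * (-1)^v * (-1)^u * x^v * x^u * ((a+k).factorial / (a+k-u).factorial) * (1 / (b+u).factorial)) * h2
  rw [Finset.sum_congr rfl h1, Finset.sum_comm, Finset.mul_sum]
  refine Finset.sum_congr rfl fun t ht => ?_
  have ht' : t ≤ k := by simpa [Nat.lt_succ_iff] using ht
  rw [← Finset.sum_filter, ← Finset.mul_sum]
  rw [show (Finset.range (k+1)).filter (fun u => u ≤ t) = Finset.range (t+1) by ext u; simp; omega]
  rw [vander a b k t ht', cf, show k + (a+b+1) - 1 + t = a+b+k+t by omega, add_comm t b]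
  ring

lemma jac (a b k : ℕ) (x : ℝ) (h0 : x ≠ 0) (h1 : x ≠ 1) :
    jacobiP a b k (2*x-1) = (-1)^k / k.factorial * ((b+k).factorial / (a+b+k).factorial) *
       ∑ t ∈ Finset.range (k+1), cf (a+b+1) b k t * x^t := by
  rw [mul_assoc ((-1)^k / (k.factorial:ℝ)), ← expand, jacobiP, itd]
  have h1' : 1 - x ≠ 0 := sub_ne_zero.2 h1.symm
  rw [show 1 - (2*x-1) = 2*(1-x) by ring, show 1 + (2*x-1) = 2*x by ring]
  have : ∀ u ∈ Finset.range (k+1), (k.choose u : ℝ) * (-1)^u *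
     ((a+k).factorial / (a+k-u).factorial) * ((b+k).factorial / (b+u).factorial) * (2*(1-x))^(k-u) * (2*x)^u =
     2^k * ((k.choose u : ℝ) * (-1)^u *
     ((a+k).factorial / (a+k-u).factorial) * ((b+k).factorial / (b+u).factorial) * (1-x)^(k-u) * x^u) := by
    intro u hu
    have hu' : u ≤ k := by simpa [Nat.lt_succ_iff] using hu
    have : (2:ℝ)^k = 2^(k-u)*2^u := by rw [← pow_add]; congr 1; omega
    rw [this, mul_pow, mul_pow]; ring
  rw [Finset.sum_congr rfl this, ← Finset.mul_sum]
  generalize (∑ u ∈ Finset.range (k+1), (_ : ℝ)) = S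
  field_simp

lemma fd0 (k : ℕ) (P : Polynomial ℝ) (hP : P.natDegree < k) :
    ∑ t ∈ Finset.range (k+1), (-1:ℝ)^t * k.choose t * P.eval (t:ℝ) = 0 := by
  have h := congrFun (Polynomial.fwdDiff_iter_eq_zero_of_degree_lt hP) 0
  rw [fwdDiff_iter_eq_sum_shift] at h
  have h2 : ∑ t ∈ Finset.range (k+1), (-1:ℝ)^t * k.choose t * P.eval (t:ℝ) = (-1)^k * 0 := by
    rw [Pi.zero_apply] at h
    rw [← h, Finset.mul_sum]
    refine Finset.sum_congr rfl fun t ht => ?_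
    have ht' : t ≤ k := by simpa [Nat.lt_succ_iff] using ht
    have e : (-1:ℝ)^t = (-1)^k * (-1)^(k-t) := by
      rw [← pow_add, show k + (k-t) = t + 2*(k-t) by omega, pow_add, pow_mul]; simp
    rw [e]; simp [mul_assoc]
  simpa using h2

lemma fdinv (k c : ℕ) :
    ∑ t ∈ Finset.range (k+1), (-1:ℝ)^t * k.choose t * (1/((t:ℝ)+(c+1))) = k.factorial * c.factorial / (c+k+1).factorial := by
  have h : ∀ k : ℕ, (fwdDiff 1)^[k] (fun n : ℕ => 1/((n:ℝ)+1)) = fun n : ℕ => (-1:ℝ)^k * k.factorial * n.factorial / (n+k+1).factorial := by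
    intro k
    induction k with
    | zero =>
      ext n
      simp [Nat.factorial_succ]
      field_simp
    | succ k ih =>
      ext n
      rw [Function.iterate_succ_apply', ih]
      simp only [fwdDiff]
      rw [show n + 1 + k + 1 = n + k + 1 + 1 by ring, show n + (k+1) + 1 = n + k + 1 + 1 by ring,
        Nat.factorial_succ (n+k+1), Nat.factorial_succ n, Nat.factorial_succ k]
      push_cast
      field_simp
      ring
  have h1 := congrFun (h k) c
  rw [fwdDiff_iter_eq_sum_shift] at h1
  have h2 : ∑ t ∈ Finset.range (k+1), (-1:ℝ)^t * k.choose t * (1/((t:ℝ)+(c+1))) = (-1)^k * ((-1)^k * k.factorial * c.factorial / (c+k+1).factorial) := by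
    rw [← h1, Finset.mul_sum]
    refine Finset.sum_congr rfl fun t ht => ?_
    have ht' : t ≤ k := by simpa [Nat.lt_succ_iff] using ht
    have e : (-1:ℝ)^t = (-1)^k * (-1)^(k-t) := by
      rw [← pow_add, show k + (k-t) = t + 2*(k-t) by omega, pow_add, pow_mul]; simp
    rw [e]; simp [mul_assoc]
    left
    ring
  rw [h2]
  have : (-1:ℝ)^k * (-1)^k = 1 := by rw [← mul_pow]; simp
  linear_combination ((k.factorial : ℝ) * c.factorial / (c+k+1).factorial) * this

/-- shifted rising factorial polynomial -/
noncomputable def rf (b c : ℕ) : Polynomial ℝ := (ascPochhammer ℝ b).comp (Polynomial.X + Polynomial.C ((c:ℝ)+1))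

lemma rf_deg (b c : ℕ) : (rf b c).natDegree = b := by
  rw [rf, Polynomial.natDegree_comp, ascPochhammer_natDegree, Polynomial.natDegree_X_add_C, mul_one]

lemma rf_eval (b c t : ℕ) : (rf b c).eval (t:ℝ) = (t+b+c).factorial / (t+c).factorial := by
  rw [rf, Polynomial.eval_comp]
  simp only [Polynomial.eval_add, Polynomial.eval_X, Polynomial.eval_C]
  rw [show (t:ℝ) + (c+1) = ((t+c+1 : ℕ):ℝ) by push_cast; ring, ascPochhammer_nat_eq_natCast_ascFactorial]
  have := Nat.factorial_mul_ascFactorial (t+c) b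
  rw [eq_div_iff (by positivity), show t+b+c = t+c+b by ring, ← this]
  push_cast; ring

lemma rf_eval_neg (k j d : ℕ) (hj : j < d) : (rf k j).eval (-((k:ℝ)+d)) = (-1)^k * (k+d-1-j).factorial / (d-1-j).factorial := by
  rw [rf, Polynomial.eval_comp]
  simp only [Polynomial.eval_add, Polynomial.eval_X, Polynomial.eval_C]
  have e : (-((k:ℝ)+d)) + (j+1) = -((k+d-1-j : ℕ):ℝ) := by
    rw [show k+d-1-j = k+d-(j+1) by omega, Nat.cast_sub (by omega)]; push_cast; ring
  rw [e, ascPochhammer_eval_neg_eq_descPochhammer, descPochhammer_eval_eq_descFactorial,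
    Nat.descFactorial_eq_div (by omega), Nat.cast_div (Nat.factorial_dvd_factorial (by omega)) (by positivity),
    show k+d-1-j-k = d-1-j by omega]
  ring

lemma orth0 (d j k b : ℕ) (hd : 1 ≤ d) (hb : b < k) :
    ∑ t ∈ Finset.range (k+1), cf d j k t * ((t+b+j).factorial / (t+b+d).factorial) = 0 := by
  rw [← fd0 k (rf (k-1-b) (b+d) * rf b j)]
  · refine Finset.sum_congr rfl fun t ht => ?_
    rw [Polynomial.eval_mul, rf_eval, rf_eval, cf, show t + (k-1-b) + (b+d) = k+d-1+t by omega, ← add_assoc t b d]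
    field_simp
  · refine lt_of_le_of_lt Polynomial.natDegree_mul_le ?_
    rw [rf_deg, rf_deg]; omega

lemma orth1 (d j k : ℕ) (hk : 1 ≤ k) (hj : j < d) :
    ∑ t ∈ Finset.range (k+1), cf d j k t * ((t+k+j).factorial / (t+k+d).factorial) =
      (-1)^k * (k+d-1-j).factorial / (d-1-j).factorial * (k.factorial * (k+d-1).factorial / (k+d+k).factorial) := by
  have hdm := Polynomial.mul_divByMonic_eq_iff_isRoot (a := (-((k:ℝ)+d))) (p := rf k j - Polynomial.C ((rf k j).eval (-((k:ℝ)+d))))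
  have hr : (rf k j - Polynomial.C ((rf k j).eval (-((k:ℝ)+d)))).IsRoot (-((k:ℝ)+d)) := by
    simp [Polynomial.IsRoot]
  have h1 := hdm.2 hr
  set R := (rf k j - Polynomial.C ((rf k j).eval (-((k:ℝ)+d)))) /ₘ (Polynomial.X - Polynomial.C (-((k:ℝ)+d))) with hR
  have hdeg : R.natDegree < k := by
    rw [hR, Polynomial.natDegree_divByMonic _ (Polynomial.monic_X_sub_C _), Polynomial.natDegree_X_sub_C,
      Polynomial.natDegree_sub_C, rf_deg]
    omega
  have hev : ∀ t : ℕ, (rf k j).eval (t:ℝ) = ((t:ℝ)+(k+d)) * R.eval (t:ℝ) + (rf k j).eval (-((k:ℝ)+d)) := by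
    intro t
    have := congrArg (Polynomial.eval (t:ℝ)) h1
    simp only [Polynomial.eval_mul, Polynomial.eval_sub, Polynomial.eval_X, Polynomial.eval_C] at this
    linear_combination -this
  rw [← rf_eval_neg k j d hj]
  have h2 := fdinv k (k+d-1)
  rw [show k+d-1+k+1 = k+d+k by omega] at h2
  rw [← h2, Finset.mul_sum, ← sub_zero (∑ t ∈ Finset.range (k+1), _ * _), ← fd0 k R hdeg, ← Finset.sum_sub_distrib]
  refine Finset.sum_congr rfl fun t ht => ?_
  have hc : (((k+d-1:ℕ):ℝ)+1) = k+d := by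
    rw [Nat.cast_sub (by omega)]; push_cast; ring
  have hp : (0:ℝ) < (t:ℝ)+(k+d) := by
    have : (1:ℝ) ≤ k := by exact_mod_cast hk
    positivity
  have hf : ((t+k+d).factorial : ℝ) = ((t:ℝ)+(k+d)) * (k+d-1+t).factorial := by
    rw [show t+k+d = (k+d-1+t)+1 by omega, Nat.factorial_succ]
    push_cast
    linear_combination ((k+d-1+t).factorial : ℝ) * hc
  have he := hev t
  rw [rf_eval] at he
  rw [hc, cf, hf]
  have : (-1:ℝ)^t * (k.choose t) * (k+d-1+t).factorial / (t+j).factorial * ((t+k+j).factorial / (((t:ℝ)+(k+d)) * (k+d-1+t).factorial))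
    = (-1:ℝ)^t * (k.choose t) * (((t+k+j).factorial : ℝ)/ (t+j).factorial) / ((t:ℝ)+(k+d)) := by
    field_simp
  rw [this, he]
  field_simp
  ring

noncomputable def DD (d j k l : ℕ) : ℝ := ∑ t ∈ Finset.range (k+1), ∑ s ∈ Finset.range (l+1),
  cf d j k t * cf d j l s * ((t+s+j).factorial / (t+s+d).factorial)

lemma DD_comm (d j k l : ℕ) : DD d j k l = DD d j l k := by
  rw [DD, Finset.sum_comm, DD]
  refine Finset.sum_congr rfl fun t _ => Finset.sum_congr rfl fun s _ => ?_
  rw [add_comm s t]; ring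

lemma DD_lt (d j k l : ℕ) (hd : 1 ≤ d) (h : l < k) : DD d j k l = 0 := by
  rw [DD, Finset.sum_comm]
  refine Finset.sum_eq_zero fun s hs => ?_
  have hs' : s ≤ l := by simpa [Nat.lt_succ_iff] using hs
  have := orth0 d j k s hd (by omega)
  rw [← mul_zero (cf d j l s), ← this, Finset.mul_sum]
  exact Finset.sum_congr rfl fun t _ => by ring

lemma DD_ne (d j k l : ℕ) (hd : 1 ≤ d) (h : k ≠ l) : DD d j k l = 0 := by
  rcases lt_or_gt_of_ne h with h | h
  · rw [DD_comm]; exact DD_lt d j l k hd h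
  · exact DD_lt d j k l hd h

lemma DD_self (d j k : ℕ) (hk : 1 ≤ k) (hj : j < d) : DD d j k k =
    k.factorial * (k+d-1-j).factorial * (k+d-1).factorial / ((k+j).factorial * (d-1-j).factorial * (2*k+d)) := by
  rw [DD, Finset.sum_comm, Finset.sum_range_succ, Finset.sum_eq_zero, zero_add]
  · have := orth1 d j k hk hj
    have h2 : ∑ t ∈ Finset.range (k+1), cf d j k t * cf d j k k * ((t+k+j).factorial / (t+k+d).factorial) = cf d j k k * ∑ t ∈ Finset.range (k+1), cf d j k t * ((t+k+j).factorial / (t+k+d).factorial) := by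
      rw [Finset.mul_sum]
      exact Finset.sum_congr rfl fun t _ => by ring
    rw [h2, this, cf]
    have e : (-1:ℝ)^k * (-1)^k = 1 := by rw [← mul_pow]; simp
    have hf : ((k+d+k).factorial : ℝ) = (2*k+d) * (k+d-1+k).factorial := by
      rw [show k+d+k = (k+d-1+k)+1 by omega, Nat.factorial_succ, show k+d-1+k+1 = 2*k+d by omega]
      push_cast; ring
    have hp : (0:ℝ) < 2*k+d := by
      have : (1:ℝ) ≤ k := by exact_mod_cast hk
      positivity
    rw [hf, Nat.choose_self, Nat.cast_one]
    field_simp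
    linear_combination e
  · intro s hs
    have hs' : s < k := by simpa using hs
    have := orth0 d j k s (by omega) hs'
    rw [← mul_zero (cf d j k s), ← this, Finset.mul_sum]
    exact Finset.sum_congr rfl fun t _ => by ring

lemma quad (d : ℕ) (β v : ℕ → ℝ) (hβ : ∀ i < d, β i ≠ 0)
    (h : ∀ i, i + 1 < d → (β i / β (i+1))^2 ≤ ((i:ℝ)+1)*(d-1-i)/((i+2)*(d-i))) (hd : 1 ≤ d) :
    1/(d:ℝ) * ∑ i ∈ Finset.range d, v i ^2 ≤
     ∑ i ∈ Finset.range d, ∑ j ∈ Finset.range d, v i * v j * (β (min i j) / β (max i j)) := by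
  have key : ∀ n, n + 1 ≤ d → 1/(d:ℝ) * ∑ i ∈ Finset.range (n+1), v i ^2 +
      ((d:ℝ)-1-n)/(d-n) * ((∑ i ∈ Finset.range (n+1), v i * β i)/β n)^2 ≤
     ∑ i ∈ Finset.range (n+1), ∑ j ∈ Finset.range (n+1), v i * v j * (β (min i j) / β (max i j)) := by
    intro n
    induction n with
    | zero =>
      intro _
      have := hβ 0 (by omega)
      have hd' : (0:ℝ) < d := by exact_mod_cast hd
      simp
      field_simp
      apply le_of_eq
      ring
    | succ n ih =>
      intro hn
      have ih := ih (by omega)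
      have hr := h n (by omega)
      have b0 := hβ n (by omega)
      have b1 := hβ (n+1) (by omega)
      have hQ : ∑ i ∈ Finset.range (n+1+1), ∑ j ∈ Finset.range (n+1+1), v i * v j * (β (min i j) / β (max i j))
        = ∑ i ∈ Finset.range (n+1), ∑ j ∈ Finset.range (n+1), v i * v j * (β (min i j) / β (max i j))
          + 2 * v (n+1) * ((∑ i ∈ Finset.range (n+1), v i * β i)/β (n+1)) + v (n+1)^2 := by
        rw [Finset.sum_range_succ]
        simp_rw [Finset.sum_range_succ _ (n+1)]
        rw [Finset.sum_add_distrib]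
        have e1 : ∑ i ∈ Finset.range (n+1), v i * v (n+1) * (β (min i (n+1)) / β (max i (n+1))) = v (n+1) * ((∑ i ∈ Finset.range (n+1), v i * β i)/β (n+1)) := by
          rw [Finset.sum_div, Finset.mul_sum]
          refine Finset.sum_congr rfl fun i hi => ?_
          have : i < n+1 := by simpa using hi
          rw [min_eq_left this.le, max_eq_right this.le]; ring
        have e2 : ∑ i ∈ Finset.range (n+1), v (n+1) * v i * (β (min (n+1) i) / β (max (n+1) i)) = v (n+1) * ((∑ i ∈ Finset.range (n+1), v i * β i)/β (n+1)) := by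
          rw [← e1]
          refine Finset.sum_congr rfl fun i hi => ?_
          rw [min_comm, max_comm]; ring
        rw [e1, e2, min_self, max_self, div_self b1]
        ring
      rw [hQ, Finset.sum_range_succ _ (n+1), Finset.sum_range_succ _ (n+1)]
      set S := ∑ i ∈ Finset.range (n+1), v i * β i with hS
      set V := ∑ i ∈ Finset.range (n+1), v i ^ 2
      set Q := ∑ i ∈ Finset.range (n+1), ∑ j ∈ Finset.range (n+1), v i * v j * (β (min i j) / β (max i j))
      set ρ := β n / β (n+1) with hρ
      have hs : S / β (n+1) = ρ * (S / β n) := by rw [hρ]; field_simp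
      have hT : (S + v (n+1) * β (n+1)) / β (n+1) = ρ * (S / β n) + v (n+1) := by
        rw [add_div, hs]; field_simp
      rw [hs, hT]
      set s := S / β n
      set w := v (n+1)
      push_cast
      have hnd : (n:ℝ) + 2 ≤ d := by exact_mod_cast hn
      have hn0 : (0:ℝ) ≤ n := by positivity
      -- need
      have p1 : (0:ℝ) < d - 1 - n := by linarith
      have p2 : (0:ℝ) < d - n := by linarith
      have p3 : (0:ℝ) < d := by linarith
      have hr' : ρ^2 * ((n+2)/(n+1)) ≤ (d-1-n)/(d-n) := by
        calc ρ^2 * ((n+2)/(n+1)) ≤ ((n:ℝ)+1)*(d-1-n)/((n+2)*(d-n)) * ((n+2)/(n+1)) := by gcongr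
          _ = _ := by field_simp
      have hs2 := mul_le_mul_of_nonneg_right hr' (sq_nonneg s)
      have hx : 0 ≤ 1/((d:ℝ)*((n+1)*(d-1-n))) * ((n+1) * (ρ*s+w) + (d-1-n) * (ρ * s))^2 := by positivity
      have ident : Q + 2*w*(ρ*s) + w^2 - (1/(d:ℝ) * (V + w^2) + ((d:ℝ)-1-(n+1))/(d-(n+1)) * (ρ*s+w)^2)
        = (Q - (1/(d:ℝ) * V + (d-1-n)/(d-n)*s^2)) + ((d-1-n)/(d-n)*s^2 - ρ^2 * ((n+2)/(n+1)) * s^2) + 1/((d:ℝ)*((n+1)*(d-1-n))) * ((n+1) * (ρ*s+w) + (d-1-n) * (ρ * s))^2 := by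
        rw [show (d:ℝ)-(n+1) = d-1-n by ring]
        field_simp
        ring
      linarith
  obtain ⟨n, rfl⟩ : ∃ n, d = n+1 := ⟨d-1, by omega⟩
  have := key n le_rfl
  simpa using this

/-- normalizing constant -/
noncomputable def nc (d i k : ℕ) : ℝ :=
  Real.sqrt ((((2*k+d) * k.factorial * (k+d-1).factorial : ℕ) : ℝ) /
      (((k+d-(i+1)).factorial * (k+i).factorial : ℕ) : ℝ)) *
  Real.sqrt (((d-(i+1)).factorial * i.factorial : ℕ) : ℝ) *
  ((-1)^k / k.factorial * ((i+k).factorial / (d-1+k).factorial))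

noncomputable def psi (d i k : ℕ) (x : ℝ) : ℝ := nc d i k * ∑ t ∈ Finset.range (k+1), cf d i k t * x^t

lemma phi_eq (d i k : ℕ) (hi : i < d) (x : ℝ) (h0 : x ≠ 0) (h1 : x ≠ 1) :
    phiB d (i+1) k x = psi d i k x := by
  rw [phiB, psi, nc, show i+1-1 = i by omega, show k+(i+1)-1 = k+i by omega, jac _ _ _ _ h0 h1,
    show d-(i+1)+i+1 = d by omega, show d-(i+1)+i+k = d-1+k by omega]
  ring

lemma nc_sq (d i k : ℕ) (hd : 1 ≤ d) : (nc d i k)^2 =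
    (2*k+d) * (d-1-i).factorial * i.factorial * (k+i).factorial / ((k+d-1-i).factorial * k.factorial * (k+d-1).factorial) := by
  rw [nc, mul_pow, mul_pow, Real.sq_sqrt (by positivity), Real.sq_sqrt (by positivity)]
  rw [show d-(i+1) = d-1-i by omega, show k+d-(i+1) = k+d-1-i by omega, add_comm i k]
  have e : (((-1:ℝ)^k)^2) = 1 := by rw [← pow_mul, mul_comm, pow_mul]; simp
  rw [show d - 1 + k = k+d-1 by omega]
  rw [mul_pow, div_pow, e]
  push_cast
  field_simp

lemma nc_ne (d i k : ℕ) (hd : 1 ≤ d) (hk : 1 ≤ k) : nc d i k ≠ 0 := by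
  intro h
  have := nc_sq d i k hd
  rw [h] at this
  have hk' : (0:ℝ) < k := by exact_mod_cast hk
  have h2 : (0:ℝ) < (2*k+d) * (d-1-i).factorial * i.factorial * (k+i).factorial / ((k+d-1-i).factorial * k.factorial * (k+d-1).factorial) := by
    positivity
  rw [← this] at h2
  simp at h2

lemma sY_compact (d : ℕ) : IsCompact (sY d 1) := by
  have : sY d 1 = (⋂ i, {x | x i ∈ Set.Icc (0:ℝ) 1}) ∩ ⋂ i, ⋂ j, ⋂ (_ : i ≤ j), {x | x i ≤ x j} := by
    ext x; simp [sY]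
  have hc : IsClosed (sY d 1) := by
    rw [this]
    refine IsClosed.inter (isClosed_iInter fun i => ?_)
      (isClosed_iInter fun i => isClosed_iInter fun j => isClosed_iInter fun _ => ?_)
    · exact isClosed_Icc.preimage (continuous_apply i)
    · exact isClosed_le (continuous_apply i) (continuous_apply j)
  refine (isCompact_univ_pi (fun _ : Fin d => isCompact_Icc (a := (0:ℝ)) (b := 1))).of_isClosed_subset hc ?_
  intro x hx i _
  exact hx.1 i

lemma cont_int (d : ℕ) (f : (Fin d → ℝ) → ℝ) (hf : Continuous f) : IntegrableOn f (sY d 1) :=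
  hf.continuousOn.integrableOn_compact (sY_compact d)

lemma psi_cont (d i k : ℕ) : Continuous (psi d i k) := by
  unfold psi; fun_prop

lemma gram_le (d : ℕ) (i j : Fin d) (hij : i ≤ j) (k l : ℕ) :
    ∫ x in sY d 1, psi d i k (x i) * psi d j l (x j) = nc d i k * nc d j l * (DD d j k l / i.1.factorial) := by
  have h1 : ∀ x : Fin d → ℝ, psi d i k (x i) * psi d j l (x j) = nc d i k * nc d j l *
     ∑ t ∈ Finset.range (k+1), ∑ s ∈ Finset.range (l+1), cf d i k t * cf d j l s * (x i ^ t * x j ^ s) := by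
    intro x
    rw [psi, psi, mul_mul_mul_comm, Finset.sum_mul_sum]
    congr 1
    exact Finset.sum_congr rfl fun t _ => Finset.sum_congr rfl fun s _ => by ring
  simp_rw [h1]
  rw [integral_const_mul, integral_finsetSum _ (fun t _ => cont_int d _ (by fun_prop))]
  congr 1
  rw [DD, Finset.sum_div]
  refine Finset.sum_congr rfl fun t _ => ?_
  rw [integral_finsetSum _ (fun t _ => cont_int d _ (by fun_prop)), Finset.sum_div]
  refine Finset.sum_congr rfl fun s _ => ?_
  rw [integral_const_mul, moment d i j hij]
  rw [cf, cf, cf]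
  field_simp

noncomputable def be (d k i : ℕ) : ℝ := nc d i k / i.factorial

lemma gram_le' (d : ℕ) (i j : Fin d) (hij : i ≤ j) (k l : ℕ) (hk : 1 ≤ k) :
    ∫ x in sY d 1, psi d i k (x i) * psi d j l (x j) = if k = l then be d k i / be d k j else 0 := by
  rw [gram_le d i j hij]
  have hj := j.2
  split_ifs with h
  · subst h
    have hs := nc_sq d j k (by omega)
    have hn := nc_ne d j k (by omega) hk
    rw [DD_self d j k hk j.2, be, be]
    have hp : (0:ℝ) < 2*k+d := by
      have : (1:ℝ) ≤ k := by exact_mod_cast hk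
      positivity
    field_simp at hs ⊢
    linear_combination (nc d i k) * hs
  · rw [DD_ne d j k l (by omega) h]; simp

lemma gram (d : ℕ) (i j : Fin d) (k l : ℕ) (hk : 1 ≤ k) (hl : 1 ≤ l) :
    ∫ x in sY d 1, psi d i k (x i) * psi d j l (x j) =
      if k = l then be d k (min i.1 j.1) / be d k (max i.1 j.1) else 0 := by
  rcases le_total i j with h | h
  · rw [gram_le' d i j h k l hk, min_eq_left (by exact h), max_eq_right (by exact h)]
  · simp_rw [mul_comm (psi d i k _)]
    rw [gram_le' d j i h l k hl, min_eq_right (by exact h), max_eq_left (by exact h)]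
    by_cases hkl : k = l
    · simp [hkl]
    · simp [hkl, Ne.symm hkl]

lemma be_ratio (d k i : ℕ) (hk : 1 ≤ k) (hi : i + 1 < d) :
    (be d k i / be d k (i+1))^2 ≤ ((i:ℝ)+1)*(d-1-i)/((i+2)*(d-i)) := by
  obtain ⟨n, rfl⟩ : ∃ n, d = n + i + 2 := ⟨d-(i+2), by omega⟩
  have hp : (0:ℝ) < 2*k+((n+i+2:ℕ):ℝ) := by positivity
  have e : (be (n+i+2) k i / be (n+i+2) k (i+1))^2 = ((i:ℝ)+1)*(n+1)/((k+i+1)*(k+n+1)) := by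
    rw [be, be, div_pow, div_pow, div_pow, nc_sq _ _ _ (by omega), nc_sq _ _ _ (by omega)]
    rw [show n+i+2-1-i = n+1 by omega, show n+i+2-1-(i+1) = n by omega,
      show k+(n+i+2)-1-i = k+n+1 by omega, show k+(n+i+2)-1-(i+1) = k+n by omega,
      ← add_assoc k i 1, Nat.factorial_succ n, Nat.factorial_succ i, Nat.factorial_succ (k+i), Nat.factorial_succ (k+n)]
    push_cast at hp ⊢
    field_simp
  rw [e]
  push_cast
  rw [show ((n:ℝ)+i+2-1-i) = n+1 by ring, show ((n:ℝ)+i+2-i) = 1+n+1 by ring, show (i:ℝ)+2 = 1+i+1 by ring]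
  have : (1:ℝ) ≤ k := by exact_mod_cast hk
  gcongr

lemma quadF (d k : ℕ) (hd : 1 ≤ d) (hk : 1 ≤ k) (v : Fin d → ℝ) :
    1/(d:ℝ) * ∑ i, v i ^2 ≤
     ∑ i, ∑ j, v i * v j * (be d k (min i.1 j.1) / be d k (max i.1 j.1)) := by
  have h := quad d (be d k) (fun n => if h : n < d then v ⟨n, h⟩ else 0)
    (fun i hi => div_ne_zero (nc_ne d i k hd hk) (by positivity)) (fun i hi => be_ratio d k i hk hi) hd
  rw [Finset.sum_range] at h
  simp_rw [Finset.sum_range] at h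
  simpa using h

/-- Norm equivalence: `‖θ‖/√d ≤ ‖θ·φ_m‖_{L²(△)} ≤ √d ‖θ‖`. -/
theorem statement11 (d : ℕ) (hd : 2 ≤ d) (m : Fin d → ℕ) (hm : ∀ i, 1 ≤ m i)
    (θ : (i : Fin d) → Fin (m i) → ℝ) :
    eunorm d m θ / Real.sqrt d
      ≤ Real.sqrt (∫ x in simplexD d, (lincomb d m θ x)^2) ∧
    Real.sqrt (∫ x in simplexD d, (lincomb d m θ x)^2)
      ≤ Real.sqrt d * eunorm d m θ := by
  have hdpos : (0:ℝ) < d := by exact_mod_cast (by omega : 0 < d)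
  have hS : simplexD d = sY d 1 := rfl
  obtain ⟨M, hM⟩ : ∃ M, ∀ i, m i ≤ M := ⟨∑ i, m i, fun i => Finset.single_le_sum (f := m) (fun _ _ => Nat.zero_le _) (Finset.mem_univ i)⟩
  let v : ℕ → Fin d → ℝ := fun k i => if h : k < m i then θ i ⟨k, h⟩ else 0
  have hsum : ∀ (i : Fin d) (F : ℕ → ℝ → ℝ), (∀ k, F k 0 = 0) → ∑ k, F k.1 (θ i k) = ∑ k ∈ Finset.range M, F k (v k i) := by
    intro i F hF
    rw [← Finset.sum_subset (Finset.range_mono (hM i)), Finset.sum_range]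
    · refine Finset.sum_congr rfl fun k _ => ?_
      simp [v]
    · intro k _ hk
      have : ¬ k < m i := by simpa using hk
      simp [v, this, hF]
  have heu : eunorm d m θ = Real.sqrt (∑ k ∈ Finset.range M, ∑ i, (v k i)^2) := by
    rw [eunorm, Finset.sum_comm]
    congr 1
    exact Finset.sum_congr rfl fun i _ => hsum i (fun _ y => y^2) (by simp)
  let f : Fin d → (Fin d → ℝ) → ℝ := fun i x => ∑ k ∈ Finset.range M, v k i * psi d i (k+1) (x i)
  have hfc : ∀ i, Continuous (f i) := by
    intro i
    have := fun k => psi_cont d i k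
    simp only [f]
    fun_prop
  have hlin : ∫ x in simplexD d, (lincomb d m θ x)^2 = ∫ x in sY d 1, (∑ i, f i x)^2 := by
    rw [hS]
    apply integral_congr_ae
    apply ae_restrict_of_ae
    have h0 : ∀ᵐ x : Fin d → ℝ, ∀ i, x i ≠ 0 := ae_all_iff.2 fun i => Measure.ae_eval_ne _ i 0
    have h1 : ∀ᵐ x : Fin d → ℝ, ∀ i, x i ≠ 1 := ae_all_iff.2 fun i => Measure.ae_eval_ne _ i 1
    filter_upwards [h0, h1] with x h0 h1
    congr 1
    rw [lincomb]
    refine Finset.sum_congr rfl fun i _ => ?_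
    rw [hsum i (fun k y => y * phiB d (i.1+1) (k+1) (x i)) (by simp)]
    exact Finset.sum_congr rfl fun k _ => by rw [phi_eq d i (k+1) i.2 _ (h0 i) (h1 i)]
  have hff : ∀ i j, ∫ x in sY d 1, f i x * f j x = ∑ k ∈ Finset.range M, v k i * v k j * (be d (k+1) (min i.1 j.1) / be d (k+1) (max i.1 j.1)) := by
    intro i j
    have ci := fun k => psi_cont d i k
    have cj := fun k => psi_cont d j k
    simp only [f]
    simp_rw [Finset.sum_mul_sum]
    rw [integral_finsetSum _ (fun k _ => cont_int d _ (by fun_prop))]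
    refine Finset.sum_congr rfl fun k hk => ?_
    rw [integral_finsetSum _ (fun k _ => cont_int d _ (by fun_prop))]
    simp_rw [mul_mul_mul_comm (v _ _) (psi _ _ _ _)]
    simp_rw [integral_const_mul, gram d i j _ _ (Nat.succ_pos _) (Nat.succ_pos _)]
    simp [Finset.sum_ite_eq, Finset.mem_range.1 hk]
  have hI : ∫ x in sY d 1, (∑ i, f i x)^2 = ∑ k ∈ Finset.range M, ∑ i, ∑ j, v k i * v k j * (be d (k+1) (min i.1 j.1) / be d (k+1) (max i.1 j.1)) := by
    simp_rw [pow_two, Finset.sum_mul_sum]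
    rw [integral_finsetSum _ (fun i _ => cont_int d _ (by fun_prop)), Finset.sum_comm]
    refine Finset.sum_congr rfl fun i _ => ?_
    rw [integral_finsetSum _ (fun j _ => cont_int d _ (by fun_prop)), Finset.sum_comm]
    exact Finset.sum_congr rfl fun j _ => hff i j
  have hlow : 1/(d:ℝ) * ∑ k ∈ Finset.range M, ∑ i, (v k i)^2 ≤ ∫ x in sY d 1, (∑ i, f i x)^2 := by
    rw [hI, Finset.mul_sum]
    exact Finset.sum_le_sum fun k _ => quadF d (k+1) (by omega) (by omega) (v k)
  have hup : ∫ x in sY d 1, (∑ i, f i x)^2 ≤ d * ∑ k ∈ Finset.range M, ∑ i, (v k i)^2 := by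
    calc ∫ x in sY d 1, (∑ i, f i x)^2 ≤ ∫ x in sY d 1, d * ∑ i, f i x * f i x := by
          apply integral_mono (cont_int d _ (by fun_prop)) (cont_int d _ (by fun_prop))
          intro x
          have := sq_sum_le_card_mul_sum_sq (s := (Finset.univ : Finset (Fin d))) (f := fun i => f i x)
          simpa [pow_two] using this
      _ = _ := by
          rw [integral_const_mul, integral_finsetSum _ (fun i _ => cont_int d _ (by fun_prop)), Finset.sum_comm]
          congr 1
          refine Finset.sum_congr rfl fun i _ => ?_
          rw [hff]
          refine Finset.sum_congr rfl fun k _ => ?_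
          have : be d (k+1) i.1 ≠ 0 := div_ne_zero (nc_ne d i (k+1) (by omega) (by omega)) (by positivity)
          rw [min_self, max_self, div_self this]; ring
  rw [hlin, heu]
  constructor
  · rw [← Real.sqrt_div' _ hdpos.le]
    apply Real.sqrt_le_sqrt
    calc _ = _ := by rw [div_eq_inv_mul, ← one_div]
      _ ≤ _ := hlow
  · rw [← Real.sqrt_mul hdpos.le]
    exact Real.sqrt_le_sqrt hup
end

section
/- If h is a polynomial of degree at most n on [0,1], then for all 1 ≤ i ≤ d, ‖h‖_∞ ≤ √(2(d-1)!) (n+d)^d ‖h‖_{L^2(q_i)}. -/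
open MeasureTheory Real

namespace Nik
open Polynomial

noncomputable def L : ℝ[X] →ₗ[ℝ] ℝ where
  toFun p := ∫ x in (0:ℝ)..1, p.eval x
  map_add' p q := by
    simp only [eval_add]
    exact intervalIntegral.integral_add (p.continuous.intervalIntegrable _ _)
      (q.continuous.intervalIntegrable _ _)
  map_smul' c p := by
    simp only [eval_smul, smul_eq_mul, RingHom.id_apply]
    exact intervalIntegral.integral_const_mul _ _

lemma L_apply (p : ℝ[X]) : L p = ∫ x in (0:ℝ)..1, p.eval x := rfl

lemma L_deriv (p : ℝ[X]) : L (derivative p) = p.eval 1 - p.eval 0 := by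
  rw [L_apply]
  exact intervalIntegral.integral_eq_sub_of_hasDerivAt (fun x _ => p.hasDerivAt x)
    ((derivative p).continuous.intervalIntegrable _ _)

lemma L_C_mul (c : ℝ) (p : ℝ[X]) : L (C c * p) = c * L p := by
  rw [← smul_eq_C_mul, map_smul, smul_eq_mul]

/-- Rodrigues-type polynomials: the `n`-th derivative of `(1-X)^(a+n) X^(b+n)` equals
`(1-X)^a X^b RR n a b`. -/
noncomputable def RR : ℕ → ℕ → ℕ → ℝ[X]
  | 0, _, _ => 1
  | n+1, a, b => C ((b:ℝ)+1) * (1 - X) * RR n (a+1) (b+1) - C ((a:ℝ)+1) * X * RR n (a+1) (b+1)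
      + X * (1 - X) * derivative (RR n (a+1) (b+1))

lemma RR_deg (n : ℕ) : ∀ a b, (RR n a b).natDegree ≤ n := by
  induction n with
  | zero => intro a b; simp [RR]
  | succ n ih =>
    intro a b
    have h := ih (a+1) (b+1)
    rw [RR]
    have hX : (1 - X : ℝ[X]).natDegree ≤ 1 := by compute_degree
    have hd : (derivative (RR n (a+1) (b+1))).natDegree ≤ n - 1 :=
      (natDegree_derivative_le _).trans (by omega)
    have e1 : (C ((b:ℝ)+1) * (1 - X)).natDegree ≤ 1 := (natDegree_C_mul_le _ _).trans hX
    have e2 : (C ((a:ℝ)+1) * X).natDegree ≤ 1 := (natDegree_C_mul_le _ _).trans natDegree_X_le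
    refine natDegree_add_le_of_degree_le
      ((natDegree_sub_le_of_le (m := n+1) (n := n+1) ?_ ?_).trans (max_self _).le) ?_
    · exact natDegree_mul_le.trans (by omega)
    · exact natDegree_mul_le.trans (by omega)
    · rcases Nat.eq_zero_or_pos n with h0 | h0
      · subst h0
        simp [RR]
      · have e3 : (X * (1 - X) : ℝ[X]).natDegree ≤ 2 :=
          natDegree_mul_le.trans (by have := natDegree_X_le (R := ℝ); omega)
        exact natDegree_mul_le.trans (by omega)

lemma RR_zero (n : ℕ) : ∀ a b, (RR n a b).eval 0 * (b.factorial : ℝ) = ((b+n).factorial : ℝ) := by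
  induction n with
  | zero => intro a b; simp [RR]
  | succ n ih =>
    intro a b
    have h := ih (a+1) (b+1)
    have e : b + (n+1) = b + 1 + n := by ring
    rw [e, ← h, RR, Nat.factorial_succ b]
    simp
    ring

lemma deriv_w (a c : ℕ) (T : ℝ[X]) :
    derivative ((1 - X)^(a+1) * X^(c+1) * T) =
      (1 - X)^a * X^c * (C ((c:ℝ)+1) * (1 - X) * T - C ((a:ℝ)+1) * X * T
        + X * (1 - X) * derivative T) := by
  simp only [derivative_mul, derivative_pow, derivative_sub, derivative_one, derivative_X,
    Nat.add_sub_cancel, Nat.cast_add, Nat.cast_one, map_add, map_one, C_eq_natCast]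
  ring

lemma RR_orth (n : ℕ) : ∀ a b (g : ℝ[X]), g.natDegree < n →
    L (g * ((1 - X)^a * X^b * RR n a b)) = 0 := by
  induction n with
  | zero => intro a b g h; omega
  | succ n ih =>
    intro a b g hg
    set H := (1 - X)^(a+1) * X^(b+1) * RR n (a+1) (b+1) with hH
    have e : g * ((1 - X)^a * X^b * RR (n+1) a b) = derivative (g * H) - derivative g * H := by
      rw [derivative_mul, hH, deriv_w, RR]; ring
    rw [e, map_sub, L_deriv]
    have z : L (derivative g * H) = 0 := by
      rcases Nat.eq_zero_or_pos g.natDegree with h0 | h0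
      · rw [natDegree_eq_zero] at h0
        obtain ⟨c, rfl⟩ := h0
        simp
      · exact ih _ _ _ (by have := natDegree_derivative_lt h0.ne'; omega)
    rw [z, hH]; simp

lemma RR_norm (n : ℕ) : ∀ a c j, L ((1 - X)^a * X^c * RR n a (c+1+j)) * (j.factorial : ℝ) =
    ((j+n).factorial : ℝ) * L ((1 - X)^(a+n) * X^c) := by
  induction n with
  | zero => intro a c j; simp [RR, mul_comm]
  | succ n ih =>
    intro a c j
    have h := ih (a+1) c (j+1)
    have e : (1 - X)^a * X^c * RR (n+1) a (c+1+j) =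
      derivative ((1 - X)^(a+1) * X^(c+1) * RR n (a+1) (c+1+(j+1)))
       + C ((j:ℝ)+1) * ((1 - X)^(a+1) * X^c * RR n (a+1) (c+1+(j+1))) := by
      rw [deriv_w, RR]
      have : c + 1 + j + 1 = c + 1 + (j+1) := by ring
      rw [this]
      push_cast
      simp only [map_add, map_one]
      ring
    rw [e, map_add, L_deriv, L_C_mul]
    have e2 : j + (n+1) = j + 1 + n := by ring
    have e3 : a + (n+1) = a + 1 + n := by ring
    rw [e2, e3, ← h, Nat.factorial_succ]
    simp
    ring

lemma L_beta (b : ℕ) : ∀ a : ℕ, L ((1 - X)^a * X^b) * ((a+b+1).factorial : ℝ) =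
    (a.factorial : ℝ) * b.factorial := by
  induction b with
  | zero =>
    intro a
    have h := L_deriv ((1 - X)^(a+1) : ℝ[X])
    have e : derivative ((1 - X)^(a+1) : ℝ[X]) = C (-((a:ℝ)+1)) * ((1 - X)^a * X^0) := by
      simp [derivative_pow]
      ring
    rw [e, L_C_mul] at h
    simp at h
    simp [Nat.factorial_succ]
    linear_combination (-(a.factorial:ℝ)) * h
  | succ b ih =>
    intro a
    have h := L_deriv ((1 - X)^(a+1) * X^(b+1) * 1 : ℝ[X])
    have e : (1 - X : ℝ[X])^a * X^b * (C ((b:ℝ)+1) * (1 - X) * 1 - C ((a:ℝ)+1) * X * 1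
        + X * (1 - X) * derivative 1) = C ((b:ℝ)+1) * ((1 - X)^(a+1) * X^b)
          - C ((a:ℝ)+1) * ((1 - X)^a * X^(b+1)) := by
      simp only [derivative_one]; ring
    rw [deriv_w, e, map_sub, L_C_mul, L_C_mul] at h
    simp at h
    have h2 := ih (a+1)
    have e2 : a + (b+1) + 1 = a + 1 + b + 1 := by ring
    rw [e2]
    have ha : ((a:ℝ)+1) ≠ 0 := by positivity
    apply mul_left_cancel₀ ha
    rw [Nat.factorial_succ a] at h2
    rw [Nat.factorial_succ b]
    push_cast at h2 ⊢
    linear_combination (-((a+1+b+1).factorial:ℝ)) * h + ((b:ℝ)+1) * h2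

lemma L_nonneg (p : ℝ[X]) (h : ∀ x ∈ Set.Icc (0:ℝ) 1, 0 ≤ p.eval x) : 0 ≤ L p :=
  intervalIntegral.integral_nonneg zero_le_one h

lemma endpoint (n a b : ℕ) (p : ℝ[X]) (hp : p.natDegree ≤ n) :
    (p.eval 0)^2 * ((n.factorial : ℝ) * (a+n).factorial * b.factorial * (b+1).factorial) ≤
      L (p^2 * ((1 - X)^a * X^b)) * ((a+b+n+1).factorial * (b+1+n).factorial) := by
  set R := RR n a (b+1) with hR
  set w : ℝ[X] := (1 - X)^a * X^b with hw
  set N := L (w * R) with hN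
  have rep : ∀ q : ℝ[X], q.natDegree ≤ n → L (q * (w * R)) = q.eval 0 * N := by
    intro q hq
    have e : q * (w * R) = C (q.eval 0) * (w * R) +
        q.divX * ((1 - X)^a * X^(b+1) * R) := by
      have := q.divX_mul_X_add
      rw [coeff_zero_eq_eval_zero] at this
      conv_lhs => rw [← this]
      rw [hw]; ring
    rw [e, map_add, L_C_mul]
    have z : L (q.divX * ((1 - X)^a * X^(b+1) * R)) = 0 := by
      rcases Nat.eq_zero_or_pos q.natDegree with h0 | h0
      · rw [natDegree_eq_zero] at h0
        obtain ⟨c, rfl⟩ := h0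
        simp
      · apply RR_orth
        rw [natDegree_divX_eq_natDegree_tsub_one]; omega
    rw [z, add_zero]
  have h1 := rep p hp
  have h2 := rep R (RR_deg _ _ _)
  have hr := RR_zero n a (b+1)
  rw [← hR] at hr
  have hn := RR_norm n a b 0
  have hb := L_beta b (a+n)
  simp only [Nat.add_zero, Nat.factorial_zero, Nat.cast_one, mul_one, Nat.zero_add] at hn
  rw [← hw, ← hR, ← hN] at hn
  set r := R.eval 0 with hrr
  set P := p.eval 0 with hP
  have hfb : (0:ℝ) < (b+1).factorial := by positivity
  have hr0 : 0 < r := by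
    by_contra hc
    have : (0:ℝ) < ((b+1+n).factorial : ℝ) := by positivity
    nlinarith
  have key : 0 ≤ L ((C r * p - C P * R)^2 * w) := by
    apply L_nonneg
    intro x hx
    have : 0 ≤ 1 - x := by linarith [hx.2]
    have := hx.1
    simp [hw]
    positivity
  have e : (C r * p - C P * R)^2 * w = C (r^2) * (p^2 * w) - C (2 * r * P) * (p * (w * R))
      + C (P^2) * (R * (w * R)) := by
    simp only [map_mul, map_pow]
    have : (C 2 : ℝ[X]) = 2 := rfl
    rw [this]; ring
  rw [e, map_add, map_sub, L_C_mul, L_C_mul, L_C_mul, h1, h2] at key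
  have key2 : P^2 * N ≤ r * L (p^2 * w) := by
    have : 0 ≤ r * (r * L (p^2 * w) - P^2 * N) := by nlinarith
    have := nonneg_of_mul_nonneg_right this hr0
    linarith
  have e4 : a + n + b + 1 = a + b + n + 1 := by ring
  rw [e4] at hb
  have hN2 : N * ((a+b+n+1).factorial : ℝ) = n.factorial * ((a+n).factorial * b.factorial) := by
    rw [hn, mul_assoc, hb]
  rw [← hr]
  have hpos : (0:ℝ) ≤ (a+b+n+1).factorial * (b+1).factorial := by positivity
  calc _ = P^2 * (N * ((a+b+n+1).factorial : ℝ)) * (b+1).factorial := by rw [hN2]; ring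
    _ = (P^2 * N) * ((a+b+n+1).factorial * (b+1).factorial) := by ring
    _ ≤ (r * L (p^2 * w)) * ((a+b+n+1).factorial * (b+1).factorial) :=
      mul_le_mul_of_nonneg_right key2 hpos
    _ = _ := by ring

lemma num (n a b : ℕ) :
    2^(a+b) * (a.factorial * b.factorial) * ((a+b+n+1).factorial * (b+1+n).factorial) ≤
    2 * (a+b).factorial * (n+(a+b+1))^(2*(a+b+1)) *
      (n.factorial * (a+n).factorial * b.factorial * (b+1).factorial) := by
  set M := n + (a+b+1) with hM
  have h1 : (a+b+n+1).factorial ≤ (a+n).factorial * M^(b+1) := by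
    have := Nat.factorial_mul_ascFactorial (a+n) (b+1)
    have h := Nat.ascFactorial_le_pow_add (a+n) (b+1)
    have e : a+b+n+1 = a+n+(b+1) := by ring
    have e' : a + n + (b+1) = M := by omega
    rw [e, ← this]
    rw [e'] at h
    exact Nat.mul_le_mul_left _ h
  have h2 : (b+1+n).factorial ≤ n.factorial * M^(b+1) := by
    have := Nat.factorial_mul_ascFactorial n (b+1)
    have h := Nat.ascFactorial_le_pow_add n (b+1)
    rw [add_comm (b+1) n, ← this]
    exact Nat.mul_le_mul_left _ (h.trans (Nat.pow_le_pow_left (by omega) _))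
  have h3 : a.factorial ≤ (a+b).factorial := Nat.factorial_le (by omega)
  have h4 : 2^b ≤ (b+1).factorial := by
    have := Nat.factorial_mul_pow_le_factorial (m := 1) (n := b)
    simpa [add_comm] using this
  have h5 : 2^a ≤ 2 * M^(2*a) := by
    rcases Nat.eq_zero_or_pos a with h | h
    · subst h; simp
    · calc 2^a ≤ M^a := Nat.pow_le_pow_left (by omega) _
        _ ≤ M^(2*a) := Nat.pow_le_pow_right (by omega) (by omega)
        _ ≤ _ := by omega
  calc _ = (2^a * 2^b) * (a.factorial * b.factorial) * ((a+b+n+1).factorial * (b+1+n).factorial) := by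
        rw [pow_add]
    _ ≤ ((2 * M^(2*a)) * (b+1).factorial) * ((a+b).factorial * b.factorial) *
        (((a+n).factorial * M^(b+1)) * (n.factorial * M^(b+1))) := by gcongr
    _ = _ := by
      have : 2 * (a+b+1) = 2 * a + (b+1) + (b+1) := by ring
      rw [this, pow_add, pow_add]; ring

/-- normalized endpoint bound -/
lemma endpoint' (n a b : ℕ) (p : ℝ[X]) (hp : p.natDegree ≤ n) :
    (p.eval 0)^2 * 2^(a+b) * (a.factorial * b.factorial) ≤
      2 * (a+b).factorial * ((n+(a+b+1) : ℕ):ℝ)^(2*(a+b+1)) *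
      L (p^2 * ((1 - X)^a * X^b)) := by
  have h := endpoint n a b p hp
  have hn : ((2^(a+b) * (a.factorial * b.factorial) * ((a+b+n+1).factorial * (b+1+n).factorial) : ℕ) : ℝ) ≤ ((2 * (a+b).factorial * (n+(a+b+1))^(2*(a+b+1)) *
      (n.factorial * (a+n).factorial * b.factorial * (b+1).factorial) : ℕ) : ℝ) :=
    Nat.cast_le.mpr (num n a b)
  rw [Nat.cast_mul, Nat.cast_mul (2 * (a+b).factorial * (n+(a+b+1))^(2*(a+b+1)))] at hn
  set A : ℝ := ((2^(a+b) * (a.factorial * b.factorial) : ℕ) : ℝ) with hA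
  set B : ℝ := ((2 * (a+b).factorial * (n+(a+b+1))^(2*(a+b+1)) : ℕ) : ℝ) with hB
  have eA : (p.eval 0)^2 * 2^(a+b) * (a.factorial * b.factorial) = (p.eval 0)^2 * A := by
    rw [hA]; push_cast; ring
  have eB : 2 * (a+b).factorial * ((n+(a+b+1) : ℕ):ℝ)^(2*(a+b+1)) = B := by
    rw [hB]; push_cast; ring
  rw [eA, eB]
  push_cast at hn
  set F : ℝ := ((a+b+n+1).factorial * (b+1+n).factorial : ℝ) with hF
  have hFp : 0 < F := by positivity
  have hB0 : 0 ≤ B := by positivity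
  set G : ℝ := ((n.factorial : ℝ) * (a+n).factorial * b.factorial * (b+1).factorial)
  refine le_of_mul_le_mul_right ?_ hFp
  calc _ = (p.eval 0)^2 * (A * F) := by ring
    _ ≤ (p.eval 0)^2 * (B * G) := mul_le_mul_of_nonneg_left hn (sq_nonneg _)
    _ = B * ((p.eval 0)^2 * G) := by ring
    _ ≤ B * (L (p^2 * ((1 - X)^a * X^b)) * F) := mul_le_mul_of_nonneg_left h hB0
    _ = _ := by ring

lemma comp_deg (n : ℕ) (p : ℝ[X]) (hp : p.natDegree ≤ n) (t s : ℝ) :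
    (p.comp (C t + C s * X)).natDegree ≤ n := by
  refine natDegree_comp_le.trans ?_
  have : (C t + C s * X).natDegree ≤ 1 := by compute_degree
  nlinarith

lemma right_part (a b : ℕ) (p : ℝ[X]) (t : ℝ) (h0 : 0 ≤ t) (h1 : t ≤ 1) :
    (1-t)^(a+b+1) * L ((p.comp (C t + C (1-t) * X))^2 * ((1 - X)^a * X^b)) ≤
      ∫ s in t..1, (p.eval s)^2 * ((1-s)^a * s^b) := by
  have e := intervalIntegral.smul_integral_comp_add_mul (a := 0) (b := 1)
    (fun s => (p.eval s)^2 * ((1-s)^a * s^b)) (1-t) t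
  simp only [mul_zero, add_zero, mul_one, add_sub_cancel, smul_eq_mul] at e
  rw [← e, pow_succ', mul_assoc, L_apply, ← intervalIntegral.integral_const_mul]
  have ht : 0 ≤ 1 - t := by linarith
  apply mul_le_mul_of_nonneg_left _ ht
  apply intervalIntegral.integral_mono_on zero_le_one
  · exact Continuous.intervalIntegrable (by fun_prop) _ _
  · exact Continuous.intervalIntegrable (by fun_prop) _ _
  · intro x hx
    have hx1 : 0 ≤ 1 - x := by linarith [hx.2]
    have hx0 := hx.1
    simp only [eval_mul, eval_pow, eval_comp, eval_add, eval_C, eval_X, eval_sub, eval_one]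
    have e1 : 1 - (t + (1-t)*x) = (1-t)*(1-x) := by ring
    have hb : ((1-t)*x)^b ≤ (t+(1-t)*x)^b := by gcongr; linarith
    rw [e1]
    calc _ = (p.eval (t+(1-t)*x))^2 * (((1-t)*(1-x))^a * ((1-t)*x)^b) := by
          rw [mul_pow, mul_pow, pow_add]; ring
      _ ≤ _ := by gcongr

lemma left_part (a b : ℕ) (p : ℝ[X]) (t : ℝ) (h0 : 0 ≤ t) (h1 : t ≤ 1) :
    t^(a+b+1) * L ((p.comp (C t + C (-t) * X))^2 * ((1 - X)^b * X^a)) ≤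
      ∫ s in (0:ℝ)..t, (p.eval s)^2 * ((1-s)^a * s^b) := by
  have e := intervalIntegral.smul_integral_comp_sub_mul (a := 0) (b := 1)
    (fun s => (p.eval s)^2 * ((1-s)^a * s^b)) t t
  simp only [mul_zero, sub_zero, mul_one, sub_self, smul_eq_mul] at e
  rw [← e, pow_succ', mul_assoc, L_apply, ← intervalIntegral.integral_const_mul]
  apply mul_le_mul_of_nonneg_left _ h0
  apply intervalIntegral.integral_mono_on zero_le_one
  · exact Continuous.intervalIntegrable (by fun_prop) _ _
  · exact Continuous.intervalIntegrable (by fun_prop) _ _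
  · intro x hx
    have hx1 : 0 ≤ 1 - x := by linarith [hx.2]
    have hx0 := hx.1
    simp only [eval_mul, eval_pow, eval_comp, eval_add, eval_C, eval_X, eval_sub, eval_one]
    have e1 : t - t*x = t*(1-x) := by ring
    have e2 : t + -t*x = t*(1-x) := by ring
    have hb : (t*x)^a ≤ (1 - t*(1-x))^a := by gcongr; linarith
    rw [e1, e2]
    calc _ = (p.eval (t*(1-x)))^2 * ((t*x)^a * (t*(1-x))^b) := by
          rw [mul_pow, mul_pow, pow_add]; ring
      _ ≤ _ := by gcongr

lemma main (n a b : ℕ) (p : ℝ[X]) (hp : p.natDegree ≤ n) (t : ℝ) (h0 : 0 ≤ t) (h1 : t ≤ 1) :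
    (p.eval t)^2 * (a.factorial * b.factorial) ≤
      2 * (a+b).factorial * ((n+(a+b+1) : ℕ):ℝ)^(2*(a+b+1)) *
      ∫ s in (0:ℝ)..1, (p.eval s)^2 * ((1-s)^a * s^b) := by
  have ci : ∀ u v : ℝ, IntervalIntegrable (fun s => (p.eval s)^2 * ((1-s)^a * s^b)) volume u v :=
    fun u v => Continuous.intervalIntegrable (by fun_prop) _ _
  rw [← intervalIntegral.integral_add_adjacent_intervals (ci 0 t) (ci t 1)]
  have hr := endpoint' n a b _ (comp_deg n p hp t (1-t))
  have hl := endpoint' n b a _ (comp_deg n p hp t (-t))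
  have r := right_part a b p t h0 h1
  have l := left_part a b p t h0 h1
  rw [add_comm b a] at hl
  simp only [eval_comp, eval_add, eval_mul, eval_C, eval_X, mul_zero, add_zero] at hr hl
  set B : ℝ := 2 * (a+b).factorial * ((n+(a+b+1) : ℕ):ℝ)^(2*(a+b+1)) with hB
  have hB0 : 0 ≤ B := by positivity
  have ht : 0 ≤ 1 - t := by linarith
  have hpw := add_pow_le h0 ht (a+b+1)
  simp only [add_sub_cancel, one_pow, Nat.add_sub_cancel] at hpw
  set E := (p.eval t)^2 * (a.factorial * b.factorial : ℝ) with hE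
  have hE0 : 0 ≤ E := by positivity
  calc E = E * 1 := by ring
    _ ≤ E * (2^(a+b) * (t^(a+b+1) + (1-t)^(a+b+1))) := mul_le_mul_of_nonneg_left hpw hE0
    _ = t^(a+b+1) * ((p.eval t)^2 * 2^(a+b) * (b.factorial * a.factorial)) +
        (1-t)^(a+b+1) * ((p.eval t)^2 * 2^(a+b) * (a.factorial * b.factorial)) := by
          rw [hE]; ring
    _ ≤ t^(a+b+1) * (B * L ((p.comp (C t + C (-t) * X))^2 * ((1 - X)^b * X^a))) +
        (1-t)^(a+b+1) * (B * L ((p.comp (C t + C (1-t) * X))^2 * ((1 - X)^a * X^b))) := by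
          gcongr
    _ = B * (t^(a+b+1) * L ((p.comp (C t + C (-t) * X))^2 * ((1 - X)^b * X^a)) +
        (1-t)^(a+b+1) * L ((p.comp (C t + C (1-t) * X))^2 * ((1 - X)^a * X^b))) := by ring
    _ ≤ _ := by gcongr

lemma integral_q (d i : ℕ) (p : ℝ[X]) :
    ∫ s, (p.eval s)^2 ∂(qMeas d i) =
      (∫ s in (0:ℝ)..1, (p.eval s)^2 * ((1-s)^(d-i) * s^(i-1))) /
        ((d-i).factorial * (i-1).factorial) := by
  have hm : Measurable (Set.indicator (Set.Icc (0:ℝ) 1)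
      (fun s : ℝ => (1-s)^(d-i) * s^(i-1) / ((d-i).factorial * (i-1).factorial))) :=
    Measurable.indicator (by fun_prop) measurableSet_Icc
  rw [qMeas, integral_withDensity_eq_integral_toReal_smul hm.ennreal_ofReal
    (Filter.Eventually.of_forall fun _ => ENNReal.ofReal_lt_top),
    intervalIntegral.integral_of_le zero_le_one, ← integral_Icc_eq_integral_Ioc,
    ← integral_div, ← integral_indicator measurableSet_Icc]
  congr 1
  ext s
  by_cases hs : s ∈ Set.Icc (0:ℝ) 1
  · have : 0 ≤ 1 - s := by linarith [hs.2]
    have := hs.1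
    simp only [Set.indicator_of_mem hs, smul_eq_mul]
    rw [ENNReal.toReal_ofReal (by positivity)]
    ring
  · simp [Set.indicator_of_notMem hs]

end Nik

/-- Nikolskii-type inequality for polynomials on `[0,1]` w.r.t. `q_i`. -/
theorem statement12 (d i n : ℕ) (hd : 2 ≤ d) (h1 : 1 ≤ i) (h2 : i ≤ d)
    (p : Polynomial ℝ) (hp : p.natDegree ≤ n) :
    ∀ t ∈ Set.Icc (0:ℝ) 1,
      |p.eval t| ≤ Real.sqrt (2 * ((d-1).factorial : ℝ)) * ((n+d : ℕ) : ℝ)^d *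
        Real.sqrt (∫ s, (p.eval s)^2 ∂(qMeas d i)) := by
  intro t ht
  have h := Nik.main n (d-i) (i-1) p hp t ht.1 ht.2
  have e1 : d - i + (i-1) = d - 1 := by omega
  have e2 : d - 1 + 1 = d := by omega
  rw [e1, e2] at h
  have hq := Nik.integral_q d i p
  have hf : (0:ℝ) < (d-i).factorial * (i-1).factorial := by positivity
  have hI : 0 ≤ ∫ s, (p.eval s)^2 ∂(qMeas d i) := integral_nonneg fun _ => sq_nonneg _
  rw [eq_div_iff hf.ne'] at hq
  rw [← hq] at h
  refine abs_le_of_sq_le_sq ?_ (by positivity)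
  rw [mul_pow, mul_pow, Real.sq_sqrt (by positivity), Real.sq_sqrt hI, ← pow_mul, mul_comm d 2]
  refine le_of_mul_le_mul_right ?_ hf
  calc _ ≤ _ := h
    _ = _ := by ring
end
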